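/- (Harris) For bond percolation on the square lattice ℤ² at parameter p = 1/2, the probability that the origin lies in an infinite open cluster is zero: θ(1/2) = 0. Consequently p_c(ℤ²) ≥ 1/2. -/

import Mathlib

open MeasureTheory

/-- `e` is an edge of the square lattice `ℤ²`: an unordered pair of vertices at
`ℓ¹`-distance `1`. -/
def IsLatticeEdge (e : Sym2 (ℤ × ℤ)) : Prop :=
  ∃ u v : ℤ × ℤ, e = s(u, v) ∧ |u.1 - v.1| + |u.2 - v.2| = 1

/-- The edges of the square lattice `ℤ²`. -/
def LatticeEdge : Type := {e : Sym2 (ℤ × ℤ) // IsLatticeEdge e}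

/-- A percolation configuration declares each edge of `ℤ²` open (`true`) or closed. -/
abbrev PercConfig : Type := LatticeEdge → Bool

instance : MeasurableSpace PercConfig := MeasurableSpace.pi

/-- `μ` is the product over the edges of `ℤ²` of Bernoulli(`p`) measures: the states of the
edges are independent, each being open with probability `p` and closed with probability
`1 - p`. -/
def IsBernoulliProduct (p : ℝ) (μ : Measure PercConfig) : Prop :=
  ∀ (S : Finset LatticeEdge) (b : LatticeEdge → Bool),
    μ {ω : PercConfig | ∀ e ∈ S, ω e = b e} =
      ∏ e ∈ S, ENNReal.ofReal (if b e then p else 1 - p)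

/-- `u` and `v` are joined by a path of open edges in the configuration `ω`. -/
def OpenConnected (ω : PercConfig) (u v : ℤ × ℤ) : Prop :=
  ∃ (k : ℕ) (x : Fin (k + 1) → ℤ × ℤ), x 0 = u ∧ x (Fin.last k) = v ∧
    ∀ i : Fin k, ∃ h : IsLatticeEdge s(x i.castSucc, x i.succ),
      ω ⟨s(x i.castSucc, x i.succ), h⟩ = true

/-- The open cluster of the origin is infinite. -/
def ClusterInfinite (ω : PercConfig) : Prop :=
  {v : ℤ × ℤ | OpenConnected ω (0, 0) v}.Infinite

/-- The cylinder of configurations agreeing with `b` on the finite set `S`. -/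
def cyl (S : Finset LatticeEdge) (b : LatticeEdge → Bool) : Set PercConfig :=
  {ω | ∀ e ∈ S, ω e = b e}

theorem measurableSet_cyl (S : Finset LatticeEdge) (b : LatticeEdge → Bool) :
    MeasurableSet (cyl S b) := by
  have : cyl S b = ⋂ e ∈ S, (fun ω : PercConfig => ω e) ⁻¹' {b e} := by
    ext ω; simp [cyl]
  rw [this]
  exact Finset.measurableSet_biInter _ fun e _ =>
    measurable_pi_apply e (MeasurableSet.singleton _)

theorem ext_of_cyl {μ ν : Measure PercConfig} [IsFiniteMeasure μ]
    (h : ∀ S b, μ (cyl S b) = ν (cyl S b)) : μ = ν := by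
  classical
  refine ext_of_generate_finite (Set.range fun x : Finset LatticeEdge × (LatticeEdge → Bool) =>
    cyl x.1 x.2) ?_ ?_ ?_ ?_
  · apply le_antisymm
    · refine iSup_le fun e => ?_
      rw [← measurable_iff_comap_le]
      refine @measurable_to_bool _ (_) _ ?_
      refine MeasurableSpace.measurableSet_generateFrom ⟨({e}, fun _ => true), ?_⟩
      ext ω; simp [cyl]
    · refine MeasurableSpace.generateFrom_le ?_
      rintro _ ⟨x, rfl⟩
      exact measurableSet_cyl _ _
  · rintro _ ⟨⟨S, b⟩, rfl⟩ _ ⟨⟨S', b'⟩, rfl⟩ ⟨ω, h1, h2⟩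
    refine ⟨(S ∪ S', ω), ?_⟩
    ext ω'
    simp only [cyl, Finset.mem_union, Set.mem_ofPred_eq, Set.mem_inter_iff] at h1 h2 ⊢
    grind
  · rintro _ ⟨x, rfl⟩
    exact h _ _
  · have := h ∅ fun _ => true
    simpa [cyl] using this

/-- The edges are independent and each is open with probability `1/2`. -/
def IsFair (μ : Measure PercConfig) : Prop :=
  ∀ S b, μ (cyl S b) = (2⁻¹ : ENNReal) ^ S.card

theorem IsFair.isProbabilityMeasure {μ : Measure PercConfig} (hμ : IsFair μ) :
    IsProbabilityMeasure μ :=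
  ⟨by simpa [cyl] using hμ ∅ fun _ => true⟩

/-- Relabel the edges by `Φ`, then flip the states of the edges where `f` is `true`. -/
def twist (Φ : LatticeEdge → LatticeEdge) (f : LatticeEdge → Bool) (ω : PercConfig) :
    PercConfig :=
  fun e => xor (ω (Φ e)) (f e)

theorem measurable_twist (Φ : LatticeEdge → LatticeEdge) (f : LatticeEdge → Bool) :
    Measurable (twist Φ f) :=
  measurable_pi_lambda _ fun e =>
    (measurable_of_finite fun b => xor b (f e)).comp (measurable_pi_apply (Φ e))

theorem IsFair.measurePreserving_twist {μ : Measure PercConfig} (hμ : IsFair μ)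
    {Φ : LatticeEdge → LatticeEdge} (hΦ : Function.Injective Φ) (f : LatticeEdge → Bool) :
    MeasurePreserving (twist Φ f) μ μ := by
  classical
  have := hμ.isProbabilityMeasure
  refine ⟨measurable_twist Φ f, ?_⟩
  have := Measure.isProbabilityMeasure_map (μ := μ) (measurable_twist Φ f).aemeasurable
  refine ext_of_cyl fun S b => ?_
  rw [Measure.map_apply (measurable_twist Φ f) (measurableSet_cyl S b), hμ]
  have : twist Φ f ⁻¹' cyl S b =
      cyl (S.image Φ) (Function.extend Φ (fun e => xor (b e) (f e)) fun _ => false) := by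
    ext ω
    simp only [cyl, twist, Set.mem_preimage, Set.mem_ofPred_eq, Finset.mem_image,
      forall_exists_index, and_imp, forall_apply_eq_imp_iff₂, hΦ.extend_apply]
    refine forall₂_congr fun e _ => ?_
    cases ω (Φ e) <;> cases f e <;> cases b e <;> simp
  rw [this, hμ, Finset.card_image_of_injective _ hΦ]

/-- The event `A` is determined by the states of the edges in `S`. -/
def DeterminedBy (S : Finset LatticeEdge) (A : Set PercConfig) : Prop :=
  ∀ ω ω' : PercConfig, (∀ e ∈ S, ω e = ω' e) → ω ∈ A → ω' ∈ A

open Classical in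
/-- The configuration whose open edges are those of `U`. -/
noncomputable def openOn (U : Finset LatticeEdge) : PercConfig := fun e => decide (e ∈ U)

theorem openOn_eq_true {U : Finset LatticeEdge} {e : LatticeEdge} :
    openOn U e = true ↔ e ∈ U := by
  simp [openOn]

open Classical in
/-- The subsets of `S` whose associated configuration lies in `A`. -/
noncomputable def traceFamily (S : Finset LatticeEdge) (A : Set PercConfig) :
    Finset (Finset LatticeEdge) :=
  S.powerset.filter fun U => openOn U ∈ A

theorem DeterminedBy.eq_biUnion {S : Finset LatticeEdge} {A : Set PercConfig}
    (h : DeterminedBy S A) : A = ⋃ U ∈ traceFamily S A, cyl S (openOn U) := by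
  classical
  ext ω
  simp only [traceFamily, Finset.mem_filter, Finset.mem_powerset, Set.mem_iUnion, exists_prop]
  constructor
  · intro hω
    have key : ∀ e ∈ S, ω e = openOn (S.filter fun e => ω e = true) e := by
      intro e he
      simp only [openOn, Finset.mem_filter, he, true_and]
      cases ω e <;> simp
    exact ⟨S.filter fun e => ω e = true, ⟨Finset.filter_subset _ _, h _ _ key hω⟩, key⟩
  · rintro ⟨U, ⟨-, hU⟩, hω⟩
    exact h _ _ (fun e he => (hω e he).symm) hU

theorem DeterminedBy.measurableSet {S : Finset LatticeEdge} {A : Set PercConfig}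
    (h : DeterminedBy S A) : MeasurableSet A := by
  rw [h.eq_biUnion]
  exact Finset.measurableSet_biUnion _ fun U _ => measurableSet_cyl _ _

theorem IsFair.measure_of_determinedBy {μ : Measure PercConfig} (hμ : IsFair μ)
    {S : Finset LatticeEdge} {A : Set PercConfig} (h : DeterminedBy S A) :
    μ A = (traceFamily S A).card * (2⁻¹ : ENNReal) ^ S.card := by
  classical
  conv_lhs => rw [h.eq_biUnion]
  rw [measure_biUnion_finset ?_ fun U _ => measurableSet_cyl _ _]
  · simp [hμ S]
  · intro U hU V hV hUV
    refine Set.disjoint_left.2 fun ω h1 h2 => hUV ?_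
    simp only [traceFamily, Finset.coe_filter, Finset.mem_powerset, Set.mem_ofPred_eq] at hU hV
    ext e
    by_cases he : e ∈ S
    · have := (h1 e he).symm.trans (h2 e he)
      simpa [openOn] using this
    · exact ⟨fun h => absurd (hU.1 h) he, fun h => absurd (hV.1 h) he⟩

/-- **Harris' inequality** for decreasing events determined by finitely many edges. -/
theorem IsFair.mul_le_measure_inter {μ : Measure PercConfig} (hμ : IsFair μ)
    {S : Finset LatticeEdge} {A B : Set PercConfig}
    (hA : DeterminedBy S A) (hB : DeterminedBy S B) (hA' : IsLowerSet A) (hB' : IsLowerSet B) :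
    μ A * μ B ≤ μ (A ∩ B) := by
  classical
  have hAB : DeterminedBy S (A ∩ B) := fun ω ω' h hω => ⟨hA _ _ h hω.1, hB _ _ h hω.2⟩
  have hmono : ∀ U V : Finset LatticeEdge, U ⊆ V → openOn U ≤ openOn V := by
    intro U V hUV e
    simp only [openOn]
    by_cases he : e ∈ U
    · simp [he, hUV he]
    · simp [he]
  have hlow : ∀ C : Set PercConfig, IsLowerSet C →
      IsLowerSet (traceFamily S C : Set (Finset LatticeEdge)) := by
    intro C hC U V hVU hU
    simp only [traceFamily, Finset.coe_filter, Finset.mem_powerset, Set.mem_ofPred_eq] at hU ⊢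
    exact ⟨hVU.trans hU.1, hC (hmono _ _ hVU) hU.2⟩
  have hsub : ∀ C : Set PercConfig, ∀ t ∈ traceFamily S C, t ⊆ S := fun C t ht =>
    Finset.mem_powerset.1 (Finset.mem_filter.1 ht).1
  have key := (hlow A hA').le_card_inter_finset' (hlow B hB') (hsub A) (hsub B)
  have hinter : traceFamily S A ∩ traceFamily S B = traceFamily S (A ∩ B) := by
    ext U; simp only [traceFamily, Finset.mem_inter, Finset.mem_filter, Set.mem_inter_iff]; tauto
  rw [hinter] at key
  have key' : ((traceFamily S A).card : ENNReal) * (traceFamily S B).card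
      ≤ 2 ^ S.card * (traceFamily S (A ∩ B)).card := by exact_mod_cast key
  rw [hμ.measure_of_determinedBy hA, hμ.measure_of_determinedBy hB,
    hμ.measure_of_determinedBy hAB]
  have h2 : (2 : ENNReal) ^ S.card * (2⁻¹ : ENNReal) ^ S.card = 1 := by
    rw [← mul_pow, ENNReal.mul_inv_cancel (by simp) (by simp), one_pow]
  calc _ = ((traceFamily S A).card : ENNReal) * (traceFamily S B).card *
        ((2⁻¹ : ENNReal) ^ S.card * (2⁻¹ : ENNReal) ^ S.card) := by ring
    _ ≤ (2 ^ S.card * (traceFamily S (A ∩ B)).card) *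
        ((2⁻¹ : ENNReal) ^ S.card * (2⁻¹ : ENNReal) ^ S.card) := by gcongr
    _ = (2 ^ S.card * (2⁻¹ : ENNReal) ^ S.card) *
        ((traceFamily S (A ∩ B)).card * (2⁻¹ : ENNReal) ^ S.card) := by ring
    _ = _ := by rw [h2, one_mul]

/-- Open all the edges of `S`. -/
noncomputable def openAll (S : Finset LatticeEdge) (ω : PercConfig) : PercConfig :=
  fun e => ω e || openOn S e

theorem IsFair.measure_preimage_openAll_le {μ : Measure PercConfig} (hμ : IsFair μ)
    (S : Finset LatticeEdge) (A : Set PercConfig) :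
    μ (openAll S ⁻¹' A) ≤ 2 ^ S.card * μ A := by
  classical
  have hsub : openAll S ⁻¹' A ⊆ ⋃ U ∈ S.powerset, twist id (openOn U) ⁻¹' A := by
    intro ω hω
    simp only [Finset.mem_powerset, Set.mem_iUnion, exists_prop]
    refine ⟨S.filter fun e => ω e = false, Finset.filter_subset _ _, ?_⟩
    have : twist id (openOn (S.filter fun e => ω e = false)) ω = openAll S ω := by
      funext e
      by_cases he : e ∈ S <;> cases h : ω e <;> simp [twist, openOn, openAll, he, h]
    rw [Set.mem_preimage, this]
    exact hω
  calc _ ≤ _ := measure_mono hsub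
    _ ≤ ∑ U ∈ S.powerset, μ (twist id (openOn U) ⁻¹' A) := measure_biUnion_finset_le _ _
    _ ≤ ∑ U ∈ S.powerset, μ A := by
      refine Finset.sum_le_sum fun U _ => ?_
      exact (hμ.measurePreserving_twist Function.injective_id _).measure_preimage_le _
    _ = _ := by simp [Finset.card_powerset]

/-- **Zero-one law**: an event that is not affected by flipping finitely many edges has
probability zero or one. -/
theorem IsFair.zero_or_one {μ : Measure PercConfig} (hμ : IsFair μ) {A : Set PercConfig}
    (hA : MeasurableSet A)
    (h : ∀ (U : Finset LatticeEdge) (ω : PercConfig), ω ∈ A → twist id (openOn U) ω ∈ A) :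
    μ A = 0 ∨ μ A = 1 := by
  classical
  have := hμ.isProbabilityMeasure
  have hle : ∀ S b b', μ (cyl S b ∩ A) ≤ μ (cyl S b' ∩ A) := by
    intro S b b'
    refine le_trans (measure_mono ?_)
      ((hμ.measurePreserving_twist Function.injective_id
        (openOn (S.filter fun e => b e ≠ b' e))).measure_preimage_le _)
    rintro ω ⟨hω, hωA⟩
    refine ⟨fun e he => ?_, h _ _ hωA⟩
    have := hω e he
    cases hb : b e <;> cases hb' : b' e <;> simp [twist, openOn, he, hb, hb', this]
  have heq : ∀ S b, μ (cyl S b ∩ A) = μ A * μ (cyl S b) := by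
    intro S b
    have huniv : DeterminedBy S (Set.univ : Set PercConfig) := fun _ _ _ _ => trivial
    have hsum : μ A = (traceFamily S Set.univ).card * μ (cyl S b ∩ A) := by
      have : A = ⋃ U ∈ traceFamily S Set.univ, cyl S (openOn U) ∩ A := by
        rw [← Set.iUnion₂_inter, ← huniv.eq_biUnion, Set.univ_inter]
      conv_lhs => rw [this]
      rw [measure_biUnion_finset ?_ fun U _ => (measurableSet_cyl _ _).inter hA]
      · simp [fun U => le_antisymm (hle S (openOn U) b) (hle S b (openOn U))]
      · intro U hU V hV hUV
        refine Set.disjoint_left.2 fun ω h1 h2 => hUV ?_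
        simp only [traceFamily, Finset.coe_filter, Finset.mem_powerset, Set.mem_ofPred_eq] at hU hV
        ext e
        by_cases he : e ∈ S
        · have := (h1.1 e he).symm.trans (h2.1 e he)
          simpa [openOn] using this
        · exact ⟨fun h => absurd (hU.1 h) he, fun h => absurd (hV.1 h) he⟩
    have h1 := hμ.measure_of_determinedBy huniv
    rw [measure_univ] at h1
    rw [hμ S b, hsum]
    calc _ = 1 * μ (cyl S b ∩ A) := by rw [one_mul]
      _ = _ := by rw [h1]; ring
  have hμA : μ.restrict A = μ A • μ := by
    refine ext_of_cyl fun S b => ?_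
    rw [Measure.restrict_apply (measurableSet_cyl S b), heq]
    simp
  have h2 : μ A = μ A * μ A := by
    have := congrArg (fun ν : Measure PercConfig => ν A) hμA
    simpa using this
  by_cases h0 : μ A = 0
  · exact Or.inl h0
  · right
    have := (ENNReal.mul_right_inj h0 (measure_ne_top μ A)).1
      (show μ A * 1 = μ A * μ A by rw [mul_one]; exact h2)
    exact this.symm

open Relation in
/-- A path leaving the set of points satisfying `p` has a first step out of it. -/
theorem exists_first_exit {α : Type*} {r : α → α → Prop} {p : α → Prop} {x y : α}
    (h : ReflTransGen r x y) (hx : p x) (hy : ¬ p y) :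
    ∃ u v, ReflTransGen (fun a b => r a b ∧ p a ∧ p b) x u ∧ p u ∧ r u v ∧ ¬ p v ∧
      ReflTransGen r v y := by
  induction h using ReflTransGen.head_induction_on with
  | refl => exact absurd hx hy
  | @head a c hac hcy ih =>
    by_cases hc : p c
    · obtain ⟨u, v, h1, h2, h3, h4, h5⟩ := ih hc
      exact ⟨u, v, h1.head ⟨hac, hx, hc⟩, h2, h3, h4, h5⟩
    · exact ⟨a, c, .refl, hx, hac, hc, hcy⟩

theorem isLatticeEdge_iff {u v : ℤ × ℤ} :
    IsLatticeEdge s(u, v) ↔ |u.1 - v.1| + |u.2 - v.2| = 1 := by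
  constructor
  · rintro ⟨a, b, h, h1⟩
    rcases Sym2.eq_iff.1 h with ⟨rfl, rfl⟩ | ⟨rfl, rfl⟩
    · exact h1
    · rw [abs_sub_comm, abs_sub_comm u.2]; exact h1
  · intro h
    exact ⟨u, v, rfl, h⟩

theorem isLatticeEdge_cases {u v : ℤ × ℤ} (h : IsLatticeEdge s(u, v)) :
    (u.1 = v.1 ∧ (v.2 = u.2 + 1 ∨ u.2 = v.2 + 1)) ∨
      (u.2 = v.2 ∧ (v.1 = u.1 + 1 ∨ u.1 = v.1 + 1)) := by
  rw [isLatticeEdge_iff] at h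
  rcases abs_cases (u.1 - v.1) with h1 | h1 <;> rcases abs_cases (u.2 - v.2) with h2 | h2 <;> omega

/-- The points `u` and `v` are the endpoints of an open edge. -/
def OpenStep (ω : PercConfig) (u v : ℤ × ℤ) : Prop :=
  ∃ h : IsLatticeEdge s(u, v), ω ⟨s(u, v), h⟩ = true

theorem OpenStep.symm {ω : PercConfig} {u v : ℤ × ℤ} (h : OpenStep ω u v) : OpenStep ω v u := by
  obtain ⟨h1, h2⟩ := h
  have e : s(u, v) = s(v, u) := Sym2.eq_swap
  refine ⟨e ▸ h1, ?_⟩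
  rw [← h2]
  congr 1
  exact Subtype.ext e.symm

open Relation in
theorem OpenConnected.reflTransGen {ω : PercConfig} {u v : ℤ × ℤ} (h : OpenConnected ω u v) :
    ReflTransGen (OpenStep ω) u v := by
  obtain ⟨k, x, rfl, rfl, hx⟩ := h
  refine Fin.induction (motive := fun i => ReflTransGen (OpenStep ω) (x 0) (x i)) .refl
    (fun i ih => ih.tail (hx i)) (Fin.last k)

theorem measurableSet_openStep (u v : ℤ × ℤ) : MeasurableSet {ω | OpenStep ω u v} := by
  by_cases h : IsLatticeEdge s(u, v)
  · have : {ω | OpenStep ω u v} = (fun ω : PercConfig => ω ⟨s(u, v), h⟩) ⁻¹' {true} := by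
      ext ω; simp [OpenStep, h]
    rw [this]
    exact measurable_pi_apply _ (MeasurableSet.singleton _)
  · simp [OpenStep, h]

/-- There is an open path with `n` steps from `v` to `w`. -/
def OpenReach (ω : PercConfig) (v : ℤ × ℤ) : ℕ → ℤ × ℤ → Prop
  | 0, w => w = v
  | n + 1, w => ∃ u, OpenReach ω v n u ∧ OpenStep ω u w

theorem measurableSet_openReach (v : ℤ × ℤ) (n : ℕ) (w : ℤ × ℤ) :
    MeasurableSet {ω | OpenReach ω v n w} := by
  induction n generalizing w with
  | zero => exact MeasurableSet.const _
  | succ n ih =>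
    have : {ω | OpenReach ω v (n + 1) w} =
        ⋃ u, {ω | OpenReach ω v n u} ∩ {ω | OpenStep ω u w} := by
      ext ω; simp [OpenReach]
    rw [this]
    exact MeasurableSet.iUnion fun u => (ih u).inter (measurableSet_openStep u w)

open Relation in
theorem reflTransGen_openStep_iff {ω : PercConfig} {v w : ℤ × ℤ} :
    ReflTransGen (OpenStep ω) v w ↔ ∃ n, OpenReach ω v n w := by
  constructor
  · intro h
    induction h with
    | refl => exact ⟨0, rfl⟩
    | tail _ h ih => obtain ⟨n, hn⟩ := ih; exact ⟨n + 1, _, hn, h⟩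
  · rintro ⟨n, hn⟩
    induction n generalizing w with
    | zero => obtain rfl : w = v := hn; exact .refl
    | succ n ih => obtain ⟨u, h1, h2⟩ := hn; exact (ih h1).tail h2

/-- The open cluster of `v`. -/
def cluster (ω : PercConfig) (v : ℤ × ℤ) : Set (ℤ × ℤ) :=
  {w | Relation.ReflTransGen (OpenStep ω) v w}

theorem measurableSet_cluster_infinite (v : ℤ × ℤ) :
    MeasurableSet {ω | (cluster ω v).Infinite} := by
  have : {ω | (cluster ω v).Infinite} =
      ⋂ F : Finset (ℤ × ℤ), ⋃ w : {w // w ∉ F}, ⋃ n, {ω | OpenReach ω v n w} := by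
    ext ω
    simp only [Set.mem_ofPred_eq, Set.mem_iInter, Set.mem_iUnion]
    constructor
    · intro h F
      obtain ⟨w, hw, hwF⟩ := h.exists_notMem_finset F
      exact ⟨⟨w, hwF⟩, reflTransGen_openStep_iff.1 hw⟩
    · intro h hfin
      obtain ⟨⟨w, hw⟩, hn⟩ := h hfin.toFinset
      exact hw (hfin.mem_toFinset.2 (reflTransGen_openStep_iff.2 hn))
  rw [this]
  exact MeasurableSet.iInter fun F => MeasurableSet.iUnion fun w =>
    MeasurableSet.iUnion fun n => measurableSet_openReach v n w

/-- Some open cluster is infinite. -/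
def percolates : Set PercConfig := {ω | ∃ v, (cluster ω v).Infinite}

theorem measurableSet_percolates : MeasurableSet percolates := by
  have : percolates = ⋃ v, {ω | (cluster ω v).Infinite} := by ext; simp [percolates]
  rw [this]
  exact MeasurableSet.iUnion measurableSet_cluster_infinite

open Relation in
theorem twist_mem_percolates (U : Finset LatticeEdge) {ω : PercConfig} (hω : ω ∈ percolates) :
    twist id (openOn U) ω ∈ percolates := by
  classical
  obtain ⟨v, hv⟩ := hω
  set ω' := twist id (openOn U) ω with hω'
  have hsub : cluster ω v ⊆ cluster ω' v ∪ ⋃ a ∈ U.biUnion fun e => e.1.toFinset, cluster ω' a := by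
    intro w hw
    induction hw with
    | refl => exact Or.inl .refl
    | @tail u w _ h ih =>
      obtain ⟨he, hop⟩ := h
      by_cases hU : (⟨s(u, w), he⟩ : LatticeEdge) ∈ U
      · refine Or.inr (Set.mem_biUnion (x := w) ?_ .refl)
        exact Finset.mem_coe.2 (Finset.mem_biUnion.2 ⟨_, hU, by simp⟩)
      · have hstep : OpenStep ω' u w := ⟨he, by
          have h1 : openOn U ⟨s(u, w), he⟩ = false := by
            exact Bool.eq_false_iff.2 fun h => hU (openOn_eq_true.1 h)
          change xor (ω ⟨s(u, w), he⟩) (openOn U ⟨s(u, w), he⟩) = true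
          rw [hop, h1]
          rfl⟩
        rcases ih with ih | ih
        · exact Or.inl (ReflTransGen.tail ih hstep)
        · right
          simp only [Set.mem_iUnion, exists_prop] at ih ⊢
          obtain ⟨a, ha, ih⟩ := ih
          exact ⟨a, ha, ReflTransGen.tail ih hstep⟩
  by_contra hcon
  have hfin : ∀ a, (cluster ω' a).Finite := fun a => by
    by_contra h
    exact hcon ⟨a, h⟩
  exact hv (((hfin v).union (Set.Finite.biUnion (Finset.finite_toSet _) fun a _ => hfin a)).subset
    hsub)

theorem IsFair.measure_percolates {μ : Measure PercConfig} (hμ : IsFair μ)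
    (h : μ {ω | ClusterInfinite ω} ≠ 0) : μ percolates = 1 := by
  refine (hμ.zero_or_one measurableSet_percolates
    fun U ω => twist_mem_percolates U).resolve_left fun h0 => h ?_
  refine measure_mono_null (fun ω hω => ?_) h0
  exact ⟨(0, 0), Set.Infinite.mono (fun v hv => OpenConnected.reflTransGen hv) hω⟩

/-- The edges with both endpoints in `B`. -/
noncomputable def edgesWithin (B : Finset (ℤ × ℤ)) : Finset LatticeEdge :=
  open Classical in B.sym2.subtype IsLatticeEdge

theorem mem_edgesWithin {B : Finset (ℤ × ℤ)} {u v : ℤ × ℤ} (h : IsLatticeEdge s(u, v)) :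
    (⟨s(u, v), h⟩ : LatticeEdge) ∈ edgesWithin B ↔ u ∈ B ∧ v ∈ B := by
  classical
  unfold edgesWithin
  exact (Finset.mem_subtype (p := IsLatticeEdge) (a := ⟨s(u, v), h⟩)).trans Finset.mk_mem_sym2_iff

/-- The square `[a, b]²`. -/
noncomputable def square (a b : ℤ) : Finset (ℤ × ℤ) := Finset.Icc a b ×ˢ Finset.Icc a b

theorem mem_square {a b : ℤ} {u : ℤ × ℤ} :
    u ∈ square a b ↔ (a ≤ u.1 ∧ u.1 ≤ b) ∧ a ≤ u.2 ∧ u.2 ≤ b := by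
  simp [square]

/-- An open step inside the set `B`. -/
def OpenStepIn (ω : PercConfig) (B : Finset (ℤ × ℤ)) (u v : ℤ × ℤ) : Prop :=
  OpenStep ω u v ∧ u ∈ B ∧ v ∈ B

/-- There is an open path from the set `T` whose last step leaves `[a, b]²` and ends in `S`. -/
def arm (a b : ℤ) (T : Finset (ℤ × ℤ)) (S : Set (ℤ × ℤ)) : Set PercConfig :=
  {ω | ∃ t ∈ T, ∃ u w, Relation.ReflTransGen (OpenStepIn ω (square a b)) t u ∧
    u ∈ square a b ∧ OpenStep ω u w ∧ w ∉ square a b ∧ w ∈ S}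

theorem determinedBy_arm (a b : ℤ) (T : Finset (ℤ × ℤ)) (S : Set (ℤ × ℤ)) :
    DeterminedBy (edgesWithin (square (a - 1) (b + 1))) (arm a b T S) := by
  intro ω ω' h
  have hstep : ∀ u w, u ∈ square a b → OpenStep ω u w → OpenStep ω' u w := by
    rintro u w hu ⟨he, ho⟩
    refine ⟨he, ?_⟩
    rw [← h _ ((mem_edgesWithin he).2 ?_)]
    · exact ho
    · have := isLatticeEdge_cases he
      simp only [mem_square] at hu ⊢
      omega
  rintro ⟨t, ht, u, w, h1, h2, h3, h4, h5⟩
  exact ⟨t, ht, u, w,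
    Relation.ReflTransGen.mono (fun x y hxy => ⟨hstep _ _ hxy.2.1 hxy.1, hxy.2⟩) _ _ h1, h2,
    hstep _ _ h2 h3, h4, h5⟩

theorem OpenStep.mono {ω ω' : PercConfig} (h : ω ≤ ω') {u v : ℤ × ℤ} (huv : OpenStep ω u v) :
    OpenStep ω' u v := by
  obtain ⟨he, ho⟩ := huv
  refine ⟨he, ?_⟩
  have := h ⟨_, he⟩
  rw [ho] at this
  exact le_antisymm le_top this

theorem isUpperSet_arm (a b : ℤ) (T : Finset (ℤ × ℤ)) (S : Set (ℤ × ℤ)) :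
    IsUpperSet (arm a b T S) := by
  rintro ω ω' h ⟨t, ht, u, w, h1, h2, h3, h4⟩
  exact ⟨t, ht, u, w, Relation.ReflTransGen.mono (fun x y hxy => ⟨hxy.1.mono h, hxy.2⟩) _ _ h1,
    h2, h3.mono h, h4⟩

theorem arm_mono_left {a b : ℤ} {T T' : Finset (ℤ × ℤ)} (hT : T ⊆ T') (S : Set (ℤ × ℤ)) :
    arm a b T S ⊆ arm a b T' S := by
  rintro ω ⟨t, ht, h⟩
  exact ⟨t, hT ht, h⟩

/-- A map of the lattice points that preserves adjacency acts on the edges. -/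
def mapEdge (φ : ℤ × ℤ → ℤ × ℤ)
    (hφ : ∀ u v, IsLatticeEdge s(u, v) → IsLatticeEdge s(φ u, φ v)) (e : LatticeEdge) :
    LatticeEdge :=
  ⟨e.1.map φ, by
    obtain ⟨e, he⟩ := e
    induction e using Sym2.ind with
    | h u v => exact hφ u v he⟩

theorem mapEdge_injective {φ : ℤ × ℤ → ℤ × ℤ}
    {hφ : ∀ u v, IsLatticeEdge s(u, v) → IsLatticeEdge s(φ u, φ v)} (hi : φ.Injective) :
    (mapEdge φ hφ).Injective := fun _ _ h =>
  Subtype.ext (Sym2.map.injective hi (congrArg Subtype.val h))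

theorem openStep_twist_mapEdge {φ : ℤ × ℤ → ℤ × ℤ}
    (hφ : ∀ u v, IsLatticeEdge s(u, v) → IsLatticeEdge s(φ u, φ v)) {ω : PercConfig}
    {u v : ℤ × ℤ} :
    OpenStep (twist (mapEdge φ hφ) (fun _ => false) ω) u v ↔
      IsLatticeEdge s(u, v) ∧ OpenStep ω (φ u) (φ v) := by
  constructor
  · rintro ⟨h, ho⟩
    exact ⟨h, hφ u v h, by simpa [twist, mapEdge] using ho⟩
  · rintro ⟨h, h', ho⟩
    exact ⟨h, by simpa [twist, mapEdge] using ho⟩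

/-- A lattice symmetry `φ` that preserves the square `[a, b]²` and the set `T`. -/
structure IsSymmetry (φ : ℤ × ℤ → ℤ × ℤ) (a b : ℤ) (T : Finset (ℤ × ℤ)) : Prop where
  edge : ∀ u v, IsLatticeEdge s(u, v) → IsLatticeEdge s(φ u, φ v)
  invol : φ.Involutive
  mem_square : ∀ u ∈ square a b, φ u ∈ square a b
  mem_block : ∀ u ∈ T, φ u ∈ T

theorem IsFair.measure_compl_arm_le {μ : Measure PercConfig} (hμ : IsFair μ)
    {φ : ℤ × ℤ → ℤ × ℤ} {a b : ℤ} {T : Finset (ℤ × ℤ)} (hφ : IsSymmetry φ a b T)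
    (S : Set (ℤ × ℤ)) : μ (arm a b T S)ᶜ ≤ μ (arm a b T (φ ⁻¹' S))ᶜ := by
  refine le_trans (measure_mono ?_) ((hμ.measurePreserving_twist
    (mapEdge_injective (hφ := hφ.edge) hφ.invol.injective) fun _ => false).measure_preimage_le _)
  rw [Set.preimage_compl]
  refine Set.compl_subset_compl.2 ?_
  rintro ω ⟨t, ht, u, w, h1, h2, h3, h4, h5⟩
  refine ⟨φ t, hφ.mem_block t ht, φ u, φ w, ?_, hφ.mem_square u h2,
    ((openStep_twist_mapEdge _).1 h3).2, fun h => h4 ?_, h5⟩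
  · refine h1.lift φ fun x y hxy => ?_
    exact ⟨((openStep_twist_mapEdge _).1 hxy.1).2, hφ.mem_square _ hxy.2.1,
      hφ.mem_square _ hxy.2.2⟩
  · rw [← hφ.invol w]
    exact hφ.mem_square _ h

/-- The **square-root trick** for two target sets exchanged by a symmetry. -/
theorem IsFair.measure_compl_arm_le_of_symmetry {μ : Measure PercConfig} (hμ : IsFair μ)
    {φ : ℤ × ℤ → ℤ × ℤ} {a b : ℤ} {T : Finset (ℤ × ℤ)} (hφ : IsSymmetry φ a b T)
    {S U : Set (ℤ × ℤ)} {ε : ENNReal}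
    (hU : ∀ u w, IsLatticeEdge s(u, w) → u ∈ square a b → w ∉ square a b → w ∈ U →
      w ∈ S ∨ φ w ∈ S)
    (h : μ (arm a b T U)ᶜ ≤ ε * ε) : μ (arm a b T S)ᶜ ≤ ε := by
  have hdet : ∀ S, DeterminedBy (edgesWithin (square (a - 1) (b + 1))) (arm a b T S)ᶜ :=
    fun S ω ω' hω h1 h2 =>
      h1 (determinedBy_arm a b T S ω' ω (fun e he => (hω e he).symm) h2)
  have hlow : ∀ S, IsLowerSet (arm a b T S)ᶜ := fun S => (isUpperSet_arm a b T S).compl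
  have hsub : (arm a b T S)ᶜ ∩ (arm a b T (φ ⁻¹' S))ᶜ ⊆ (arm a b T U)ᶜ := by
    rintro ω ⟨h1, h2⟩ ⟨t, ht, u, w, h3, h4, h5, h6, h7⟩
    rcases hU u w h5.1 h4 h6 h7 with h8 | h8
    · exact h1 ⟨t, ht, u, w, h3, h4, h5, h6, h8⟩
    · exact h2 ⟨t, ht, u, w, h3, h4, h5, h6, h8⟩
  have key : μ (arm a b T S)ᶜ * μ (arm a b T S)ᶜ ≤ ε * ε :=
    calc μ (arm a b T S)ᶜ * μ (arm a b T S)ᶜ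
      _ ≤ μ (arm a b T S)ᶜ * μ (arm a b T (φ ⁻¹' S))ᶜ :=
        mul_le_mul' le_rfl (hμ.measure_compl_arm_le hφ S)
      _ ≤ μ ((arm a b T S)ᶜ ∩ (arm a b T (φ ⁻¹' S))ᶜ) :=
        hμ.mul_le_measure_inter (hdet _) (hdet _) (hlow _) (hlow _)
      _ ≤ ε * ε := (measure_mono hsub).trans h
  by_contra! hlt
  exact absurd key (not_le.2 (ENNReal.mul_lt_mul hlt hlt))

theorem isSymmetry_swap (a b c d : ℤ) : IsSymmetry Prod.swap a b (square c d) where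
  edge u v h := by rw [isLatticeEdge_iff] at h ⊢; simpa [add_comm] using h
  invol u := by simp
  mem_square u h := by simp only [mem_square, Prod.fst_swap, Prod.snd_swap] at h ⊢; tauto
  mem_block u h := by simp only [mem_square, Prod.fst_swap, Prod.snd_swap] at h ⊢; tauto

theorem isSymmetry_reflect_fst {a b c d : ℤ} (h : a + b = c + d) :
    IsSymmetry (fun u => (a + b - u.1, u.2)) a b (square c d) where
  edge u v h := by
    rw [isLatticeEdge_iff] at h ⊢
    simpa [abs_sub_comm v.1 u.1] using h
  invol u := by simp
  mem_square u h := by simp only [mem_square] at h ⊢; omega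
  mem_block u h := by simp only [mem_square] at h ⊢; omega

theorem isSymmetry_reflect_snd {a b c d : ℤ} (h : a + b = c + d) :
    IsSymmetry (fun u => (u.1, a + b - u.2)) a b (square c d) where
  edge u v h := by
    rw [isLatticeEdge_iff] at h ⊢
    simpa [abs_sub_comm v.2 u.2] using h
  invol u := by simp
  mem_square u h := by simp only [mem_square] at h ⊢; omega
  mem_block u h := by simp only [mem_square] at h ⊢; omega

theorem IsFair.measure_compl_arm_sides {μ : Measure PercConfig} (hμ : IsFair μ)
    {a b c d : ℤ} (hs : a + b = c + d) {ε : ENNReal} (hε : ε ≤ 1)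
    (h : μ (arm a b (square c d) Set.univ)ᶜ ≤ ε ^ 8) :
    μ (arm a b (square c d) {w | b < w.1})ᶜ ≤ ε ∧
    μ (arm a b (square c d) {w | w.1 < a})ᶜ ≤ ε ∧
    μ (arm a b (square c d) {w | b < w.2 ∧ 2 * w.1 ≤ a + b})ᶜ ≤ ε ∧
    μ (arm a b (square c d) {w | w.2 < a ∧ 2 * w.1 ≤ a + b})ᶜ ≤ ε ∧
    μ (arm a b (square c d) {w | b < w.2 ∧ a + b ≤ 2 * w.1})ᶜ ≤ ε ∧
    μ (arm a b (square c d) {w | w.2 < a ∧ a + b ≤ 2 * w.1})ᶜ ≤ ε := by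
  have hsw := isSymmetry_swap a b c d
  have hr1 := isSymmetry_reflect_fst hs
  have hr2 := isSymmetry_reflect_snd hs
  have h1 : μ (arm a b (square c d) {w | b < w.2 ∨ w.2 < a})ᶜ ≤ ε ^ 4 := by
    refine hμ.measure_compl_arm_le_of_symmetry hsw (U := Set.univ) ?_ (h.trans_eq (by ring))
    intro u w he hu hw _
    have := isLatticeEdge_cases he
    simp only [mem_square, Set.mem_ofPred_eq, Prod.snd_swap] at *
    omega
  have h2 : μ (arm a b (square c d) {w | b < w.2})ᶜ ≤ ε ^ 2 := by
    refine hμ.measure_compl_arm_le_of_symmetry hr2 ?_ (h1.trans_eq (by ring))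
    intro u w he hu hw h
    simp only [Set.mem_ofPred_eq] at *
    omega
  have h3 : μ (arm a b (square c d) {w | b < w.2 ∧ 2 * w.1 ≤ a + b})ᶜ ≤ ε := by
    refine hμ.measure_compl_arm_le_of_symmetry hr1 ?_ (h2.trans_eq (by ring))
    intro u w he hu hw h
    simp only [Set.mem_ofPred_eq] at *
    omega
  have h3' : μ (arm a b (square c d) {w | b < w.2 ∧ a + b ≤ 2 * w.1})ᶜ ≤ ε := by
    refine hμ.measure_compl_arm_le_of_symmetry hr1 ?_ (h2.trans_eq (by ring))
    intro u w he hu hw h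
    simp only [Set.mem_ofPred_eq] at *
    omega
  have hε2 : ε ^ 2 ≤ ε := by
    calc ε ^ 2 = ε * ε := by ring
      _ ≤ ε * 1 := by gcongr
      _ = ε := mul_one ε
  have h4 : μ (arm a b (square c d) {w | b < w.1})ᶜ ≤ ε :=
    ((hμ.measure_compl_arm_le hsw _).trans h2).trans hε2
  refine ⟨h4, ?_, h3, ?_, h3', ?_⟩
  · refine (hμ.measure_compl_arm_le hr1 _).trans (le_trans (le_of_eq ?_) h4)
    congr 3; ext w; simp only [Set.mem_preimage, Set.mem_ofPred_eq]; omega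
  · refine (hμ.measure_compl_arm_le hr2 _).trans (le_trans (le_of_eq ?_) h3)
    congr 3; ext w; simp only [Set.mem_preimage, Set.mem_ofPred_eq]; omega
  · refine (hμ.measure_compl_arm_le hr2 _).trans (le_trans (le_of_eq ?_) h3')
    congr 3; ext w; simp only [Set.mem_preimage, Set.mem_ofPred_eq]; omega

theorem IsFair.exists_block {μ : Measure PercConfig} (hμ : IsFair μ)
    (h : μ {ω | ClusterInfinite ω} ≠ 0) {ε : ENNReal} (hε : ε ≠ 0) :
    ∃ m : ℕ, ∀ a b : ℤ, a ≤ -m → m ≤ b →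
      μ (arm a b (square (-m) m) Set.univ)ᶜ ≤ ε := by
  have := hμ.isProbabilityMeasure
  set P : ℕ → Set PercConfig := fun m => {ω | ∃ v ∈ square (-m) m, (cluster ω v).Infinite} with hP
  have hmono : Monotone P := by
    rintro m m' hm ω ⟨v, hv, h⟩
    refine ⟨v, ?_, h⟩
    rw [mem_square] at hv ⊢
    omega
  have hunion : ⋃ m, P m = percolates := by
    ext ω
    simp only [Set.mem_iUnion]
    constructor
    · rintro ⟨m, v, -, hv⟩
      exact ⟨v, hv⟩
    · rintro ⟨v, hv⟩
      refine ⟨v.1.natAbs + v.2.natAbs, v, ?_, hv⟩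
      rw [mem_square]
      omega
  have hmeas : ∀ m, MeasurableSet (P m) := fun m => by
    have : P m = ⋃ v ∈ square (-m) m, {ω | (cluster ω v).Infinite} := by
      ext; simp [hP]
    rw [this]
    exact Finset.measurableSet_biUnion _ fun v _ => measurableSet_cluster_infinite v
  have hlim : Filter.Tendsto (fun m => μ (P m)ᶜ) Filter.atTop (nhds 0) := by
    have h0 : μ (⋂ m, (P m)ᶜ) = 0 := by
      rw [← Set.compl_iUnion, hunion, prob_compl_eq_zero_iff measurableSet_percolates]
      exact hμ.measure_percolates h
    rw [← h0]
    exact tendsto_measure_iInter_atTop (fun m => (hmeas m).compl.nullMeasurableSet)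
      (fun m m' hm => Set.compl_subset_compl.2 (hmono hm)) ⟨0, measure_ne_top _ _⟩
  obtain ⟨m, hm⟩ := (hlim.eventually (ge_mem_nhds (pos_iff_ne_zero.2 hε))).exists
  refine ⟨m, fun a b ha hb => (measure_mono (Set.compl_subset_compl.2 ?_)).trans hm⟩
  rintro ω ⟨v, hv, hinf⟩
  obtain ⟨w, hw, hwb⟩ := hinf.exists_notMem_finset (square a b)
  have hvb : v ∈ square a b := by rw [mem_square] at hv ⊢; omega
  obtain ⟨u, w', h1, h2, h3, h4, -⟩ := exists_first_exit (p := fun x => x ∈ square a b) hw hvb hwb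
  exact ⟨v, hv, u, w', h1, h2, h3, h4, trivial⟩

/-- The edge crossed by `e` when `e` is viewed as an edge of the dual lattice, in which the
vertex with index `(i, j)` is the point `(i + 1/2, j + 1/2)`. -/
def dualEdge (e : LatticeEdge) : LatticeEdge :=
  ⟨Sym2.lift ⟨fun u v => s(u ⊔ v, u ⊓ v + (1, 1)),
    fun u v => by simp only [sup_comm, inf_comm]⟩ e.1, by
    obtain ⟨e, he⟩ := e
    induction e using Sym2.ind with
    | h u v =>
      rw [Sym2.lift_mk, isLatticeEdge_iff]
      obtain ⟨a, b⟩ := u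
      obtain ⟨c, d⟩ := v
      rcases isLatticeEdge_cases he with ⟨h1, h2 | h2⟩ | ⟨h1, h2 | h2⟩ <;>
        simp only at h1 h2 <;> subst h1 h2 <;> simp⟩

theorem dualEdge_injective : dualEdge.Injective := by
  rintro ⟨e, he⟩ ⟨e', he'⟩ h
  have h := congrArg Subtype.val h
  refine Subtype.ext ?_
  induction e using Sym2.ind with
  | h u v =>
    induction e' using Sym2.ind with
    | h u' v' =>
      obtain ⟨a, b⟩ := u
      obtain ⟨c, d⟩ := v
      obtain ⟨a', b'⟩ := u'
      obtain ⟨c', d'⟩ := v'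
      have h1 := isLatticeEdge_cases he
      have h2 := isLatticeEdge_cases he'
      simp only [dualEdge, Sym2.lift_mk, Sym2.eq_iff, Prod.ext_iff, Prod.mk_sup_mk, Prod.mk_inf_mk,
        Prod.mk_add_mk] at h h1 h2 ⊢
      omega

theorem openStep_twist_dualEdge {ω : PercConfig} {p q : ℤ × ℤ} :
    OpenStep (twist dualEdge (fun _ => true) ω) p q ↔
      IsLatticeEdge s(p, q) ∧ ¬ OpenStep ω (p ⊔ q) (p ⊓ q + (1, 1)) := by
  constructor
  · rintro ⟨h, ho⟩
    refine ⟨h, fun ⟨h', ho'⟩ => ?_⟩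
    have : ω (dualEdge ⟨s(p, q), h⟩) = true := ho'
    simp [twist, this] at ho
  · rintro ⟨h, hn⟩
    refine ⟨h, ?_⟩
    have : ω (dualEdge ⟨s(p, q), h⟩) = false := by
      rw [Bool.eq_false_iff]
      exact fun h' => hn ⟨(dualEdge ⟨s(p, q), h⟩).2, h'⟩
    simp [twist, this]

/-- A step of the dual lattice that does not cross an edge of the graph `Q`. -/
def DualStep (Q : ℤ × ℤ → ℤ × ℤ → Prop) (p q : ℤ × ℤ) : Prop :=
  IsLatticeEdge s(p, q) ∧ ¬ Q (p ⊔ q) (p ⊓ q + (1, 1))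

theorem DualStep.symm {Q : ℤ × ℤ → ℤ × ℤ → Prop} {p q : ℤ × ℤ} (h : DualStep Q p q) :
    DualStep Q q p := by
  unfold DualStep
  rw [Sym2.eq_swap, sup_comm, inf_comm]
  exact h

/-- The signed number of times the dual step from `p` to `q` crosses the horizontal half-line
that starts at `v` and goes to the right. -/
def crossing (p q v : ℤ × ℤ) : ℤ :=
  if p.1 = q.1 ∧ v.1 ≤ p.1 then
    (if q.2 = p.2 + 1 ∧ v.2 = q.2 then 1 else 0) - (if p.2 = q.2 + 1 ∧ v.2 = p.2 then 1 else 0)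
  else 0

/-- The indicator of the half-strip of dual vertices to the right of the vertical edge that joins
`(i, j)` to `(i, j + 1)`. -/
def halfStrip (i j : ℤ) (p : ℤ × ℤ) : ℤ := if i ≤ p.1 ∧ p.2 = j then 1 else 0

/-- The function `F` behaves like the signed number of times a dual path from `s` to `t` that
avoids the graph `Q` crosses horizontal half-lines. -/
structure IsPotential (Q : ℤ × ℤ → ℤ × ℤ → Prop) (s t : ℤ × ℤ) (F : ℤ × ℤ → ℤ) : Prop where
  horizontal : ∀ i j, Q (i, j) (i + 1, j) → F (i, j) = F (i + 1, j)
  vertical : ∀ i j, Q (i, j) (i, j + 1) →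
    F (i, j) - F (i, j + 1) = halfStrip i j t - halfStrip i j s

theorem isPotential_crossing {Q : ℤ × ℤ → ℤ × ℤ → Prop} {p q : ℤ × ℤ} (h : DualStep Q p q) :
    IsPotential Q p q (crossing p q) := by
  obtain ⟨h, hQ⟩ := h
  obtain ⟨a, b⟩ := p
  obtain ⟨c, d⟩ := q
  rcases isLatticeEdge_cases h with ⟨h1, h2 | h2⟩ | ⟨h1, h2 | h2⟩ <;>
    simp only at h1 h2 <;> subst h1 h2 <;>
    simp only [Prod.mk_sup_mk, Prod.mk_inf_mk, Prod.mk_add_mk, sup_idem, inf_idem,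
      sup_of_le_right, sup_of_le_left, inf_of_le_left, inf_of_le_right, le_add_iff_nonneg_right,
      zero_le_one] at hQ <;>
    refine ⟨fun i j hij => ?_, fun i j hij => ?_⟩
  · have : ¬ (i = a ∧ j = b + 1) := by rintro ⟨rfl, rfl⟩; exact hQ hij
    simp only [crossing, true_and]; split_ifs <;> omega
  · simp only [crossing, halfStrip, true_and]; split_ifs <;> omega
  · have : ¬ (i = a ∧ j = d + 1) := by rintro ⟨rfl, rfl⟩; exact hQ hij
    simp only [crossing, true_and]; split_ifs <;> omega
  · simp only [crossing, halfStrip, true_and]; split_ifs <;> omega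
  · simp only [crossing]; split_ifs <;> omega
  · have : ¬ (i = a + 1 ∧ j = b) := by rintro ⟨rfl, rfl⟩; exact hQ hij
    simp only [crossing, halfStrip]; split_ifs <;> omega
  · simp only [crossing]; split_ifs <;> omega
  · have : ¬ (i = c + 1 ∧ j = b) := by rintro ⟨rfl, rfl⟩; exact hQ hij
    simp only [crossing, halfStrip]; split_ifs <;> omega

theorem IsPotential.add {Q : ℤ × ℤ → ℤ × ℤ → Prop} {s t u : ℤ × ℤ} {F G : ℤ × ℤ → ℤ}
    (hF : IsPotential Q s t F) (hG : IsPotential Q t u G) : IsPotential Q s u (F + G) where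
  horizontal i j h := by
    simp only [Pi.add_apply, hF.horizontal i j h, hG.horizontal i j h]
  vertical i j h := by
    have h1 := hF.vertical i j h
    have h2 := hG.vertical i j h
    simp only [Pi.add_apply]
    omega

open Relation in
theorem exists_isPotential {Q : ℤ × ℤ → ℤ × ℤ → Prop} {n : ℤ} {s t : ℤ × ℤ}
    (h : ReflTransGen (fun p q => DualStep Q p q ∧ p ∈ square (-n) (n - 1) ∧
      q ∈ square (-n) (n - 1)) s t) :
    ∃ F, IsPotential Q s t F ∧ ∀ v : ℤ × ℤ, n ≤ v.2 ∨ v.2 ≤ -n ∨ n ≤ v.1 → F v = 0 := by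
  induction h with
  | refl => exact ⟨0, ⟨fun _ _ _ => rfl, fun _ _ _ => by simp⟩, fun _ _ => rfl⟩
  | @tail p q _ h ih =>
    obtain ⟨F, hF, hF0⟩ := ih
    refine ⟨F + crossing p q, hF.add (isPotential_crossing h.1), fun v hv => ?_⟩
    have h1 := h.2
    simp only [mem_square] at h1
    simp only [Pi.add_apply, hF0 v hv, crossing]
    split_ifs <;> omega

open Relation in
/-- A potential whose endpoints lie outside the relevant strips is constant along the paths of
`Q` in the square `[-n, n]²`. -/
theorem IsPotential.eq_of_reflTransGen {Q : ℤ × ℤ → ℤ × ℤ → Prop} {n : ℤ} {s t : ℤ × ℤ}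
    {F : ℤ × ℤ → ℤ} (hF : IsPotential Q s t F)
    (hs : n ≤ s.2 ∨ s.2 < -n ∨ s.1 < -n) (ht : n ≤ t.2 ∨ t.2 < -n ∨ t.1 < -n)
    (hQ : ∀ u v, Q u v → Q v u ∧ IsLatticeEdge s(u, v) ∧ u ∈ square (-n) n)
    {u v : ℤ × ℤ} (h : ReflTransGen Q u v) : F u = F v := by
  have hzero : ∀ p : ℤ × ℤ, n ≤ p.2 ∨ p.2 < -n ∨ p.1 < -n →
      ∀ i j, (i, j) ∈ square (-n) n → (i, j + 1) ∈ square (-n) n → halfStrip i j p = 0 := by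
    intro p hp i j h1 h2
    simp only [mem_square] at h1 h2
    rw [halfStrip, if_neg]
    omega
  have hvert : ∀ i j, Q (i, j) (i, j + 1) → F (i, j) = F (i, j + 1) := by
    intro i j h
    have h1 := hF.vertical i j h
    have h2 := (hQ _ _ h).2.2
    have h3 := (hQ _ _ (hQ _ _ h).1).2.2
    rw [hzero s hs i j h2 h3, hzero t ht i j h2 h3] at h1
    omega
  induction h with
  | refl => rfl
  | @tail p q _ h ih =>
    rw [ih]
    obtain ⟨h1, h2, -⟩ := hQ _ _ h
    obtain ⟨a, b⟩ := p
    obtain ⟨c, d⟩ := q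
    rcases isLatticeEdge_cases h2 with ⟨h3, h4 | h4⟩ | ⟨h3, h4 | h4⟩ <;>
      simp only at h3 h4 <;> subst h3 h4
    · exact hvert _ _ h
    · exact (hvert _ _ h1).symm
    · exact hF.horizontal _ _ h
    · exact (hF.horizontal _ _ h1).symm

open Relation in
theorem reflTransGen_symm {α : Type*} {r : α → α → Prop} (hr : ∀ x y, r x y → r y x) {x y : α}
    (h : ReflTransGen r x y) : ReflTransGen r y x := by
  induction h with
  | refl => exact .refl
  | tail _ h ih => exact ih.head (hr _ _ h)

open Relation in
/-- A square is connected. -/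
theorem reflTransGen_of_mem_square {a b : ℤ} {r : ℤ × ℤ → ℤ × ℤ → Prop}
    (hr : ∀ u v, IsLatticeEdge s(u, v) → u ∈ square a b → v ∈ square a b → r u v) {p q : ℤ × ℤ}
    (hp : p ∈ square a b) (hq : q ∈ square a b) : ReflTransGen r p q := by
  obtain ⟨k, hk⟩ : ∃ k, (p.1 - q.1).natAbs + (p.2 - q.2).natAbs = k := ⟨_, rfl⟩
  induction k generalizing p with
  | zero =>
    have : p = q := by ext <;> omega
    rw [this]
  | succ k ih =>
    have key : ∃ p' : ℤ × ℤ, IsLatticeEdge s(p, p') ∧ p' ∈ square a b ∧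
        (p'.1 - q.1).natAbs + (p'.2 - q.2).natAbs = k := by
      simp only [mem_square] at hp hq ⊢
      rcases lt_trichotomy p.1 q.1 with h | h | h
      · refine ⟨(p.1 + 1, p.2), isLatticeEdge_iff.2 (by simp), ?_⟩; simp only; omega
      · rcases lt_or_ge p.2 q.2 with h' | h'
        · refine ⟨(p.1, p.2 + 1), isLatticeEdge_iff.2 (by simp), ?_⟩; simp only; omega
        · refine ⟨(p.1, p.2 - 1), isLatticeEdge_iff.2 (by simp), ?_⟩; simp only; omega
      · refine ⟨(p.1 - 1, p.2), isLatticeEdge_iff.2 (by simp), ?_⟩; simp only; omega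
    obtain ⟨p', h1, h2, h3⟩ := key
    exact (ih h2 h3).head (hr _ _ h1 hp h2)

/-- The potential of a dual path that comes in through the right half of the top side of the
square and leaves through the right half of the bottom side or through the left side. -/
theorem exists_isPotential_of_crossing {Q : ℤ × ℤ → ℤ × ℤ → Prop} {n : ℤ} (hn : 0 < n)
    {u w u' w' : ℤ × ℤ}
    (hu : u ∈ square (-n) (n - 1)) (huw : DualStep Q u w) (hw : n ≤ w.2) (hw0 : 0 ≤ w.1)
    (hu' : u' ∈ square (-n) (n - 1)) (huw' : DualStep Q u' w')
    (hw' : w'.2 < -n ∧ 0 ≤ w'.1 ∨ w'.1 < -n)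
    (h : Relation.ReflTransGen (fun p q => DualStep Q p q ∧ p ∈ square (-n) (n - 1) ∧
      q ∈ square (-n) (n - 1)) u u') :
    ∃ F, IsPotential Q w w' F ∧ (∀ v : ℤ × ℤ, n ≤ v.1 → F v = 0) ∧
      (∀ v : ℤ × ℤ, v.2 = n → v.1 ≤ 0 → F v = -1) ∧
      (∀ v : ℤ × ℤ, v.2 = -n → v.1 ≤ 0 → F v = if w'.2 < -n then -1 else 0) := by
  obtain ⟨F, hF, hF0⟩ := exists_isPotential h
  refine ⟨crossing w u + F + crossing u' w', ((isPotential_crossing huw.symm).add hF).add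
    (isPotential_crossing huw'), fun v h1 => ?_, fun v h1 h2 => ?_, fun v h1 h2 => ?_⟩
  all_goals
    have h3 := isLatticeEdge_cases huw.1
    have h4 := isLatticeEdge_cases huw'.1
    simp only [mem_square] at hu hu'
    rw [Pi.add_apply, Pi.add_apply, hF0 v (by omega)]
    simp only [crossing]
    split_ifs <;> omega

/-- The steps of the open paths in `[-n, n]²` that avoid `[-m, m]²`. -/
def OpenStepOff (ω : PercConfig) (m n : ℤ) (u v : ℤ × ℤ) : Prop :=
  OpenStepIn ω (square (-n) n) u v ∧ u ∉ square (-m) m ∧ v ∉ square (-m) m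

/-- Dual arms separate the boundary of a square into three parts. -/
theorem not_reflTransGen_openStepOff {ω : PercConfig} {m n : ℤ} (hm : 0 ≤ m) (hmn : m < n)
    (h1 : twist dualEdge (fun _ => true) ω ∈
      arm (-n) (n - 1) (square (-m - 1) m) {w | n - 1 < w.2 ∧ -n + (n - 1) ≤ 2 * w.1})
    (h2 : twist dualEdge (fun _ => true) ω ∈
      arm (-n) (n - 1) (square (-m - 1) m) {w | w.2 < -n ∧ -n + (n - 1) ≤ 2 * w.1})
    (h3 : twist dualEdge (fun _ => true) ω ∈
      arm (-n) (n - 1) (square (-m - 1) m) {w | w.1 < -n})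
    {e f g : ℤ × ℤ} (he : n ≤ e.1) (hf : f.2 = n) (hf' : f.1 ≤ 0) (hg : g.2 = -n)
    (hg' : g.1 ≤ 0) :
    ¬ Relation.ReflTransGen (OpenStepOff ω m n) e f ∧
    ¬ Relation.ReflTransGen (OpenStepOff ω m n) e g ∧
    ¬ Relation.ReflTransGen (OpenStepOff ω m n) f g := by
  obtain ⟨t1, ht1, u1, w1, hr1, hu1, hs1, -, hw1⟩ := h1
  obtain ⟨t2, ht2, u2, w2, hr2, hu2, hs2, -, hw2⟩ := h2
  obtain ⟨t3, ht3, u3, w3, hr3, hu3, hs3, -, hw3⟩ := h3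
  simp only [Set.mem_ofPred_eq] at hw1 hw2 hw3
  set Q := OpenStepOff ω m n with hQ
  have hdual : ∀ {p q}, OpenStep (twist dualEdge (fun _ => true) ω) p q → DualStep Q p q := by
    intro p q h
    rw [openStep_twist_dualEdge] at h
    exact ⟨h.1, fun h' => h.2 h'.1.1⟩
  set D := fun p q => DualStep Q p q ∧ p ∈ square (-n) (n - 1) ∧ q ∈ square (-n) (n - 1) with hD
  have hDsymm : ∀ p q, D p q → D q p := fun p q h => ⟨h.1.symm, h.2.2, h.2.1⟩
  have hpath : ∀ {t u}, Relation.ReflTransGen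
      (OpenStepIn (twist dualEdge (fun _ => true) ω) (square (-n) (n - 1))) t u →
      Relation.ReflTransGen D t u := fun h =>
    Relation.ReflTransGen.mono (fun p q h => ⟨hdual h.1, h.2⟩) _ _ h
  have hblock : ∀ {t t'}, t ∈ square (-m - 1) m → t' ∈ square (-m - 1) m →
      Relation.ReflTransGen D t t' := by
    refine reflTransGen_of_mem_square fun p q h hp hq => ⟨⟨h, fun h' => ?_⟩, ?_, ?_⟩
    · obtain ⟨-, h5, h6⟩ := h'
      have h7 := isLatticeEdge_cases h
      obtain ⟨a, b⟩ := p
      obtain ⟨c, d⟩ := q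
      simp only [mem_square, Prod.mk_sup_mk, Prod.mk_inf_mk, Prod.mk_add_mk] at h5 h6 hp hq h7
      omega
    · rw [mem_square] at hp ⊢; omega
    · rw [mem_square] at hq ⊢; omega
  have hsym : ∀ u v, Q u v → Q v u ∧ IsLatticeEdge s(u, v) ∧ u ∈ square (-n) n := fun u v h =>
    ⟨⟨⟨h.1.1.symm, h.1.2.2, h.1.2.1⟩, h.2.2, h.2.1⟩, h.1.1.1, h.1.2.1⟩
  obtain ⟨F, hF, hFe, hFf, hFg⟩ := exists_isPotential_of_crossing (by omega) hu1 (hdual hs1)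
    (by omega) (by omega) hu2 (hdual hs2) (by omega)
    (((reflTransGen_symm hDsymm (hpath hr1)).trans (hblock ht1 ht2)).trans (hpath hr2))
  obtain ⟨G, hG, -, hGf, hGg⟩ := exists_isPotential_of_crossing (by omega) hu1 (hdual hs1)
    (by omega) (by omega) hu3 (hdual hs3) (by omega)
    (((reflTransGen_symm hDsymm (hpath hr1)).trans (hblock ht1 ht3)).trans (hpath hr3))
  have hw3' : ¬ w3.2 < -n := by
    have := isLatticeEdge_cases hs3.1
    rw [mem_square] at hu3
    omega
  specialize hFe e he
  specialize hFf f hf hf'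
  specialize hFg g hg hg'
  specialize hGf f hf hf'
  specialize hGg g hg hg'
  rw [if_pos hw2.1] at hFg
  rw [if_neg hw3'] at hGg
  refine ⟨fun h => ?_, fun h => ?_, fun h => ?_⟩
  · have := hF.eq_of_reflTransGen (by omega) (by omega) hsym h
    omega
  · have := hF.eq_of_reflTransGen (by omega) (by omega) hsym h
    omega
  · have := hG.eq_of_reflTransGen (by omega) (by omega) hsym h
    omega

/-- The steps of `r` that avoid the set `S`. -/
def StepOff {V : Type*} (r : V → V → Prop) (S : Set V) (x y : V) : Prop := r x y ∧ x ∉ S ∧ y ∉ S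

open Relation in
theorem reflTransGen_and_of_forall {V : Type*} {r : V → V → Prop} {p : V → Prop} {x y : V}
    (h : ReflTransGen r x y) (hp : ∀ z, ReflTransGen r x z → p z) :
    ReflTransGen (fun u v => r u v ∧ p u ∧ p v) x y := by
  induction h with
  | refl => exact .refl
  | tail h1 h2 ih => exact ih.tail ⟨h2, hp _ h1, hp _ (h1.tail h2)⟩

open Relation in
theorem exists_root {V : Type*} {r : V → V → Prop} (hr : ∀ x y, r x y → r y x) :
    ∃ ρ : V → V, (∀ x, ReflTransGen r x (ρ x)) ∧ ∀ x y, ReflTransGen r x y → ρ x = ρ y := by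
  let s : Setoid V := ⟨ReflTransGen r, fun _ => .refl, reflTransGen_symm hr, .trans⟩
  refine ⟨fun x => (Quotient.mk s x).out, fun x => ?_, fun x y h => ?_⟩
  · exact reflTransGen_symm hr (Quotient.exact (s := s) (Quotient.out_eq (Quotient.mk s x)))
  · have : Quotient.mk s x = Quotient.mk s y := Quotient.sound h
    simp only [this]

/-- A graph together with pairwise disjoint connected sets `T i`, pointed by `t i`. -/
structure DisjointBlocks {V ι : Type*} (r : V → V → Prop) (T : ι → Set V) (t : ι → V) : Prop where
  symm : ∀ x y, r x y → r y x
  mem : ∀ i, t i ∈ T i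
  disjoint : ∀ i j, i ≠ j → ∀ x ∈ T i, x ∉ T j
  connected : ∀ i, ∀ x ∈ T i, Relation.ReflTransGen (fun u v => r u v ∧ u ∈ T i ∧ v ∈ T i) x (t i)

namespace DisjointBlocks

open Relation

variable {V ι : Type*} {r : V → V → Prop} {T : ι → Set V} {t : ι → V}

theorem stepOff_symm (hT : DisjointBlocks r T t) (i : ι) {x y : V}
    (h : ReflTransGen (StepOff r (T i)) x y) : ReflTransGen (StepOff r (T i)) y x :=
  reflTransGen_symm (fun x y h => ⟨hT.symm x y h.1, h.2.2, h.2.1⟩) h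

theorem reflTransGen_point (hT : DisjointBlocks r T t) {i j : ι} (hij : i ≠ j) {x : V}
    (hx : x ∈ T i) : ReflTransGen (StepOff r (T j)) x (t i) :=
  ReflTransGen.mono (fun u v h => ⟨h.1, hT.disjoint i j hij u h.2.1, hT.disjoint i j hij v h.2.2⟩)
    _ _ (hT.connected i x hx)

theorem notMem_of_not_reflTransGen (hT : DisjointBlocks r T t) {i j : ι} (hij : i ≠ j) {x : V}
    (h : ¬ ReflTransGen (StepOff r (T i)) x (t j)) {z : V}
    (hz : ReflTransGen (StepOff r (T i)) x z) : z ∉ T j :=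
  fun hzj => h (hz.trans (hT.reflTransGen_point hij.symm hzj))

theorem reflTransGen_of_not (hT : DisjointBlocks r T t) {i j : ι} (hij : i ≠ j) {x y : V}
    (h : ¬ ReflTransGen (StepOff r (T i)) x (t j)) (hxy : ReflTransGen (StepOff r (T i)) x y) :
    ReflTransGen (StepOff r (T j)) x y :=
  ReflTransGen.mono (fun _ _ h => ⟨h.1.1, h.2⟩) _ _
    (reflTransGen_and_of_forall hxy fun _ hz => hT.notMem_of_not_reflTransGen hij h hz)

theorem reflTransGen_point_of_not (hT : DisjointBlocks r T t) {i j : ι} (hij : i ≠ j) {x : V}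
    (h : ¬ ReflTransGen (StepOff r (T i)) x (t j)) (hx : ReflTransGen r x (t i)) :
    ReflTransGen (StepOff r (T j)) x (t i) := by
  by_cases hxi : x ∈ T i
  · exact hT.reflTransGen_point hij hxi
  · obtain ⟨u, z, h1, h2, h3, h4, -⟩ := exists_first_exit (p := fun y => y ∉ T i) hx hxi
      (not_not.2 (hT.mem i))
    have h4 := not_not.1 h4
    have h5 : ReflTransGen (StepOff r (T i)) x u := h1
    exact ((hT.reflTransGen_of_not hij h h5).tail ⟨h3, hT.notMem_of_not_reflTransGen hij h h5,
      hT.disjoint i j hij z h4⟩).trans (hT.reflTransGen_point hij h4)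

/-- The points outside `T i` that `T i` separates from the root of their component. -/
def descendants (r : V → V → Prop) (T : ι → Set V) (t : ι → V) (ρ : V → V) (i : ι) : Set V :=
  {a | a ∉ T i ∧ ReflTransGen r a (t i) ∧ ¬ ReflTransGen (StepOff r (T i)) (ρ (t i)) a}

theorem descendants_subset (hT : DisjointBlocks r T t) {ρ : V → V}
    (hρ : ∀ x, ReflTransGen r x (ρ x)) (hρ' : ∀ x y, ReflTransGen r x y → ρ x = ρ y) {i j : ι}
    (hij : i ≠ j) {d d' : V} (hd : d ∈ descendants r T t ρ i) (hd' : d' ∈ descendants r T t ρ i)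
    (hdd' : ¬ ReflTransGen (StepOff r (T i)) d d')
    (hj : ReflTransGen (StepOff r (T i)) d (t j)) :
    descendants r T t ρ j ⊆ descendants r T t ρ i ∧ d' ∉ descendants r T t ρ j := by
  have hle : ∀ {k x y}, ReflTransGen (StepOff r (T k)) x y → ReflTransGen r x y :=
    fun h => ReflTransGen.mono (fun _ _ h => h.1) _ _ h
  have hji : ReflTransGen r (t j) (t i) := (reflTransGen_symm hT.symm (hle hj)).trans hd.2.1
  have hroot : ρ (t j) = ρ (t i) := hρ' _ _ hji
  have hρj : ¬ ReflTransGen (StepOff r (T i)) (ρ (t i)) (t j) := fun h =>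
    hd.2.2 (h.trans (hT.stepOff_symm i hj))
  have hρi := hT.reflTransGen_point_of_not hij hρj (reflTransGen_symm hT.symm (hρ (t i)))
  constructor
  · rintro a ⟨-, ha2, ha3⟩
    rw [hroot] at ha3
    refine ⟨fun h => ha3 ?_, ha2.trans hji, fun h => ha3 ?_⟩
    · exact hρi.trans (hT.stepOff_symm j (hT.reflTransGen_point hij h))
    · exact hT.reflTransGen_of_not hij hρj h
  · rintro ⟨-, -, h3⟩
    rw [hroot] at h3
    refine h3 (hρi.trans (hT.stepOff_symm j (hT.reflTransGen_point_of_not hij (fun h => ?_)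
      hd'.2.1)))
    exact hdd' (hj.trans (hT.stepOff_symm i h))

theorem card_le_of_descendants (hT : DisjointBlocks r T t) {ρ : V → V}
    (hρ : ∀ x, ReflTransGen r x (ρ x)) (hρ' : ∀ x y, ReflTransGen r x y → ρ x = ρ y)
    (J : Finset ι) (B : Finset V)
    (h : ∀ i ∈ J, ∃ b ∈ B, ∃ c ∈ B, b ∈ descendants r T t ρ i ∧ c ∈ descendants r T t ρ i ∧
      ¬ ReflTransGen (StepOff r (T i)) b c) : J.card ≤ B.card := by
  classical
  induction hk : J.card generalizing J B with
  | zero => exact Nat.zero_le _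
  | succ k ih =>
    have hJ : J.Nonempty := Finset.card_pos.1 (by omega)
    obtain ⟨i, hi, hmin⟩ := J.exists_min_image
      (fun i => (B.filter fun a => a ∈ descendants r T t ρ i).card) hJ
    obtain ⟨b, hb, c, hc, hbD, hcD, hbc⟩ := h i hi
    have key : ∀ d ∈ B, ∀ d' ∈ B, d ∈ descendants r T t ρ i → d' ∈ descendants r T t ρ i →
        ¬ ReflTransGen (StepOff r (T i)) d d' → ∀ j ∈ J, i ≠ j →
        ¬ ReflTransGen (StepOff r (T i)) d (t j) := by
      intro d hd d' hd' hdD hdD' hdd' j hj hij hdj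
      obtain ⟨h1, h2⟩ := hT.descendants_subset hρ hρ' hij hdD hdD' hdd' hdj
      refine absurd (hmin j hj) (not_le.2 (Finset.card_lt_card ?_))
      refine Finset.ssubset_iff_subset_ne.2 ⟨fun a ha => ?_, fun heq => h2 ?_⟩
      · rw [Finset.mem_filter] at ha ⊢
        exact ⟨ha.1, h1 ha.2⟩
      · have : d' ∈ B.filter fun a => a ∈ descendants r T t ρ i := Finset.mem_filter.2 ⟨hd', hdD'⟩
        rw [← heq] at this
        exact (Finset.mem_filter.1 this).2
    have hsame : ∀ j ∈ J, i ≠ j → ReflTransGen (StepOff r (T j)) b c := fun j hj hij =>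
      (hT.reflTransGen_point_of_not hij (key b hb c hc hbD hcD hbc j hj hij) hbD.2.1).trans
        (hT.stepOff_symm j (hT.reflTransGen_point_of_not hij (key c hc b hb hcD hbD
          (fun h => hbc (hT.stepOff_symm i h)) j hj hij) hcD.2.1))
    have hne : b ≠ c := fun h => hbc (h ▸ .refl)
    have hb' : b ∈ B.erase c := Finset.mem_erase.2 ⟨hne, hb⟩
    have hbj : ∀ j ∈ J, i ≠ j → c ∈ descendants r T t ρ j → b ∈ descendants r T t ρ j := by
      intro j hj hij hcj
      have h1 := hsame j hj hij
      refine ⟨?_, ?_, fun h => hcj.2.2 (h.trans h1)⟩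
      · rcases ReflTransGen.cases_head h1 with h2 | ⟨x, h2, -⟩
        · exact absurd h2 hne
        · exact h2.2.1
      · exact (ReflTransGen.mono (fun _ _ h => h.1) _ _ h1 : ReflTransGen r b c).trans hcj.2.1
    have := ih (J.erase i) (B.erase c) ?_ (by rw [Finset.card_erase_of_mem hi]; omega)
    · rw [Finset.card_erase_of_mem hc] at this
      have := Finset.card_pos.2 ⟨c, hc⟩
      omega
    · intro j hj
      obtain ⟨hji, hj⟩ := Finset.mem_erase.1 hj
      have hs := hsame j hj hji.symm
      obtain ⟨x, hx, y, hy, hxD, hyD, hxy⟩ := h j hj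
      by_cases hxc : x = c
      · subst hxc
        have hyc : y ≠ x := fun h => hxy (h ▸ .refl)
        exact ⟨b, hb', y, Finset.mem_erase.2 ⟨hyc, hy⟩, hbj j hj hji.symm hxD, hyD,
          fun h => hxy ((hT.stepOff_symm j hs).trans h)⟩
      · by_cases hyc : y = c
        · subst hyc
          exact ⟨x, Finset.mem_erase.2 ⟨hxc, hx⟩, b, hb', hxD, hbj j hj hji.symm hyD,
            fun h => hxy (h.trans hs)⟩
        · exact ⟨x, Finset.mem_erase.2 ⟨hxc, hx⟩, y, Finset.mem_erase.2 ⟨hyc, hy⟩, hxD, hyD, hxy⟩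

/-- **Burton-Keane**: there are at most as many trifurcations as boundary points. -/
theorem card_le [Fintype ι] (hT : DisjointBlocks r T t) (B : Finset V)
    (h : ∀ i, ∃ a ∈ B, ∃ b ∈ B, ∃ c ∈ B, (a ∉ T i ∧ b ∉ T i ∧ c ∉ T i) ∧
      (ReflTransGen r a (t i) ∧ ReflTransGen r b (t i) ∧ ReflTransGen r c (t i)) ∧
      ¬ ReflTransGen (StepOff r (T i)) a b ∧ ¬ ReflTransGen (StepOff r (T i)) a c ∧
      ¬ ReflTransGen (StepOff r (T i)) b c) : Fintype.card ι ≤ B.card := by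
  obtain ⟨ρ, hρ, hρ'⟩ := exists_root hT.symm
  refine hT.card_le_of_descendants hρ hρ' Finset.univ B fun i _ => ?_
  obtain ⟨a, ha, b, hb, c, hc, ⟨ha1, hb1, hc1⟩, ⟨ha2, hb2, hc2⟩, hab, hac, hbc⟩ := h i
  have hpair : ∀ {x y}, ¬ ReflTransGen (StepOff r (T i)) x y →
      ReflTransGen (StepOff r (T i)) (ρ (t i)) x →
      ¬ ReflTransGen (StepOff r (T i)) (ρ (t i)) y := fun h1 h2 h3 =>
    h1 ((hT.stepOff_symm i h2).trans h3)
  by_cases h1 : ReflTransGen (StepOff r (T i)) (ρ (t i)) a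
  · exact ⟨b, hb, c, hc, ⟨hb1, hb2, hpair hab h1⟩, ⟨hc1, hc2, hpair hac h1⟩, hbc⟩
  · by_cases h2 : ReflTransGen (StepOff r (T i)) (ρ (t i)) b
    · exact ⟨a, ha, c, hc, ⟨ha1, ha2, h1⟩, ⟨hc1, hc2, hpair hbc h2⟩, hac⟩
    · exact ⟨a, ha, b, hb, ⟨ha1, ha2, h1⟩, ⟨hb1, hb2, h2⟩, hab⟩

end DisjointBlocks

theorem OpenStepIn.congr {B : Finset (ℤ × ℤ)} {ω ω' : PercConfig}
    (h : ∀ e ∈ edgesWithin B, ω e = ω' e) : OpenStepIn ω B = OpenStepIn ω' B := by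
  funext u v
  refine propext ⟨fun ⟨⟨h1, h2⟩, h3⟩ => ⟨⟨h1, ?_⟩, h3⟩, fun ⟨⟨h1, h2⟩, h3⟩ => ⟨⟨h1, ?_⟩, h3⟩⟩
  · rw [← h _ ((mem_edgesWithin h1).2 h3)]
    exact h2
  · rw [h _ ((mem_edgesWithin h1).2 h3)]
    exact h2

/-- The block `[-m, m]²` is fully open and has three arms to the boundary of `[-n, n]²` that are
not connected to each other outside of the block. -/
def trifurcation (m n : ℤ) : Set PercConfig :=
  {ω | (∀ e ∈ edgesWithin (square (-m) m), ω e = true) ∧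
    ∃ a b c, (a ∉ square (-(n - 1)) (n - 1) ∧ b ∉ square (-(n - 1)) (n - 1) ∧
        c ∉ square (-(n - 1)) (n - 1)) ∧
      (Relation.ReflTransGen (OpenStepIn ω (square (-n) n)) (0, 0) a ∧
        Relation.ReflTransGen (OpenStepIn ω (square (-n) n)) (0, 0) b ∧
        Relation.ReflTransGen (OpenStepIn ω (square (-n) n)) (0, 0) c) ∧
      ¬ Relation.ReflTransGen (OpenStepOff ω m n) a b ∧
      ¬ Relation.ReflTransGen (OpenStepOff ω m n) a c ∧
      ¬ Relation.ReflTransGen (OpenStepOff ω m n) b c}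

theorem edgesWithin_mono {B B' : Finset (ℤ × ℤ)} (h : B ⊆ B') :
    edgesWithin B ⊆ edgesWithin B' := by
  rintro ⟨e, he⟩ h1
  induction e using Sym2.ind with
  | h u v =>
    obtain ⟨hu, hv⟩ := (mem_edgesWithin he).1 h1
    exact (mem_edgesWithin he).2 ⟨h hu, h hv⟩

theorem square_subset {a b c d : ℤ} (h1 : c ≤ a) (h2 : b ≤ d) : square a b ⊆ square c d := by
  intro u hu
  rw [mem_square] at hu ⊢
  omega

theorem determinedBy_trifurcation {m n : ℤ} (hmn : m ≤ n) :
    DeterminedBy (edgesWithin (square (-n) n)) (trifurcation m n) := by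
  rintro ω ω' h ⟨h1, h2⟩
  have hstep := OpenStepIn.congr h
  have hoff : OpenStepOff ω m n = OpenStepOff ω' m n := by
    funext u v
    unfold OpenStepOff
    rw [hstep]
  rw [hstep, hoff] at h2
  refine ⟨fun e he => ?_, h2⟩
  rw [← h e (edgesWithin_mono (square_subset (by omega) hmn) he)]
  exact h1 e he

theorem mem_trifurcation_of_arms {ω : PercConfig} {m n : ℤ} (hm : 0 ≤ m) (hmn : m < n)
    (h1 : ω ∈ arm (-(n - 1)) (n - 1) (square (-m) m) {w | n - 1 < w.1})
    (h2 : ω ∈ arm (-(n - 1)) (n - 1) (square (-m) m)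
      {w | n - 1 < w.2 ∧ 2 * w.1 ≤ -(n - 1) + (n - 1)})
    (h3 : ω ∈ arm (-(n - 1)) (n - 1) (square (-m) m)
      {w | w.2 < -(n - 1) ∧ 2 * w.1 ≤ -(n - 1) + (n - 1)})
    (h4 : twist dualEdge (fun _ => true) ω ∈
      arm (-n) (n - 1) (square (-m - 1) m) {w | n - 1 < w.2 ∧ -n + (n - 1) ≤ 2 * w.1})
    (h5 : twist dualEdge (fun _ => true) ω ∈
      arm (-n) (n - 1) (square (-m - 1) m) {w | w.2 < -n ∧ -n + (n - 1) ≤ 2 * w.1})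
    (h6 : twist dualEdge (fun _ => true) ω ∈
      arm (-n) (n - 1) (square (-m - 1) m) {w | w.1 < -n}) :
    openAll (edgesWithin (square (-m) m)) ω ∈ trifurcation m n := by
  set ω' := openAll (edgesWithin (square (-m) m)) ω with hω'
  have hle : ω ≤ ω' := fun e => by
    simp only [hω', openAll]
    exact Bool.left_le_or _ _
  have hopen : ∀ e ∈ edgesWithin (square (-m) m), ω' e = true := fun e he => by
    simp only [hω', openAll, openOn_eq_true.2 he, Bool.or_true]
  have harm : ∀ {S}, ω ∈ arm (-(n - 1)) (n - 1) (square (-m) m) S →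
      ∃ w ∈ S, w ∉ square (-(n - 1)) (n - 1) ∧ w ∈ square (-n) n ∧
        Relation.ReflTransGen (OpenStepIn ω' (square (-n) n)) (0, 0) w := by
    rintro S ⟨t, ht, u, w, h1, h2, h3, h4, h5⟩
    have hw : w ∈ square (-n) n := by
      have := isLatticeEdge_cases h3.1
      rw [mem_square] at h2 ⊢
      omega
    have hsub : square (-(n - 1)) (n - 1) ⊆ square (-n) n := square_subset (by omega) (by omega)
    have hsub' : square (-m) m ⊆ square (-n) n := square_subset (by omega) (by omega)
    refine ⟨w, h5, h4, hw, Relation.ReflTransGen.tail (b := u) ?_ ⟨h3.mono hle, hsub h2, hw⟩⟩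
    refine Relation.ReflTransGen.trans (b := t) ?_
      (Relation.ReflTransGen.mono (fun x y h => ⟨h.1.mono hle, hsub h.2.1, hsub h.2.2⟩) _ _ h1)
    refine reflTransGen_of_mem_square (a := -m) (b := m) (fun x y h hx hy => ?_) ?_ ht
    · exact ⟨⟨h, hopen _ ((mem_edgesWithin h).2 ⟨hx, hy⟩)⟩, hsub' hx, hsub' hy⟩
    · simp [mem_square, hm]
  have hoff : ∀ {u v}, Relation.ReflTransGen (OpenStepOff ω' m n) u v →
      Relation.ReflTransGen (OpenStepOff ω m n) u v := fun h =>
    Relation.ReflTransGen.mono (fun x y h => by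
      obtain ⟨⟨⟨h1, h2⟩, h3⟩, h4⟩ := h
      refine ⟨⟨⟨h1, ?_⟩, h3⟩, h4⟩
      have : ¬ (⟨s(x, y), h1⟩ : LatticeEdge) ∈ edgesWithin (square (-m) m) := fun h =>
        h4.1 ((mem_edgesWithin h1).1 h).1
      exact (Bool.or_eq_true_iff.1 h2).resolve_right fun h => this (openOn_eq_true.1 h)) _ _ h
  obtain ⟨e, he, he1, he2, he3⟩ := harm h1
  obtain ⟨f, hf, hf1, hf2, hf3⟩ := harm h2
  obtain ⟨g, hg, hg1, hg2, hg3⟩ := harm h3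
  simp only [Set.mem_ofPred_eq] at he hf hg
  rw [mem_square] at he2 hf2 hg2
  obtain ⟨k1, k2, k3⟩ := not_reflTransGen_openStepOff (e := e) (f := f) (g := g) hm hmn h4 h5 h6
    (by omega) (by omega) (by omega) (by omega) (by omega)
  exact ⟨hopen, e, f, g, ⟨he1, hf1, hg1⟩, ⟨he3, hf3, hg3⟩, fun h => k1 (hoff h),
    fun h => k2 (hoff h), fun h => k3 (hoff h)⟩

theorem IsFair.exists_measure_trifurcation {μ : Measure PercConfig} (hμ : IsFair μ)
    (h : μ {ω | ClusterInfinite ω} ≠ 0) :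
    ∃ m k : ℕ, ∀ n : ℤ, m < n → 1 ≤ 2 ^ k * μ (trifurcation m n) := by
  have := hμ.isProbabilityMeasure
  set ε : ENNReal := 12⁻¹ with hε
  have hε1 : ε ≤ 1 := by rw [hε]; exact ENNReal.inv_le_one.2 (by norm_num)
  obtain ⟨m, hm⟩ := hμ.exists_block h (ε := ε ^ 8) (by simp [hε])
  refine ⟨m, (edgesWithin (square (-m) m)).card + 1, fun n hn => ?_⟩
  obtain ⟨p1, -, p2, p3, -, -⟩ := hμ.measure_compl_arm_sides (a := -(n - 1)) (b := n - 1)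
    (by omega) hε1 (hm _ _ (by omega) (by omega))
  obtain ⟨-, p6, -, -, p4, p5⟩ := hμ.measure_compl_arm_sides (a := -n) (b := n - 1)
    (c := -m - 1) (d := m) (by omega) hε1 ((measure_mono (Set.compl_subset_compl.2
      (arm_mono_left (square_subset (by omega) le_rfl) _))).trans (hm _ _ (by omega) (by omega)))
  set τ := twist dualEdge fun _ => true
  have hτ : MeasurePreserving τ μ μ := hμ.measurePreserving_twist dualEdge_injective _
  replace p4 := (hτ.measure_preimage_le _).trans p4
  replace p5 := (hτ.measure_preimage_le _).trans p5
  replace p6 := (hτ.measure_preimage_le _).trans p6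
  have hbad : μ (openAll (edgesWithin (square (-m) m)) ⁻¹' trifurcation m n)ᶜ ≤ 2⁻¹ := by
    refine le_trans (measure_mono ?_) (le_trans (measure_union_le _ _) (le_trans (add_le_add
      (le_trans (measure_union_le _ _) (add_le_add (le_trans (measure_union_le _ _)
        (add_le_add p1 p2)) p3)) (le_trans (measure_union_le _ _) (add_le_add
          (le_trans (measure_union_le _ _) (add_le_add p4 p5)) p6))) ?_))
    · intro ω hω
      by_contra hcon
      simp only [Set.mem_union, Set.mem_compl_iff, Set.mem_preimage, not_or, not_not] at hcon
      obtain ⟨⟨⟨h1, h2⟩, h3⟩, ⟨h4, h5⟩, h6⟩ := hcon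
      exact hω (mem_trifurcation_of_arms (by omega) hn h1 h2 h3 h4 h5 h6)
    · have : ε + ε + ε + (ε + ε + ε) = 6 * ε := by ring
      rw [this, hε, show (12 : ENNReal) = 6 * 2 by norm_num, ENNReal.mul_inv (by simp) (by simp),
        ← mul_assoc, ENNReal.mul_inv_cancel (by simp) (by simp), one_mul]
  have hgood : 2⁻¹ ≤ μ (openAll (edgesWithin (square (-m) m)) ⁻¹' trifurcation m n) := by
    have h1 := measure_univ_le_add_compl (μ := μ)
      (openAll (edgesWithin (square (-m) m)) ⁻¹' trifurcation m n)
    rw [measure_univ, ← ENNReal.inv_two_add_inv_two] at h1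
    exact (ENNReal.add_le_add_iff_right (by simp)).1 (h1.trans (add_le_add le_rfl hbad))
  calc (1 : ENNReal) = 2 * 2⁻¹ := (ENNReal.mul_inv_cancel (by simp) (by simp)).symm
    _ ≤ 2 * (2 ^ (edgesWithin (square (-m) m)).card * μ (trifurcation m n)) :=
      mul_le_mul' le_rfl (hgood.trans (hμ.measure_preimage_openAll_le _ _))
    _ = _ := by ring

open Relation in
/-- An arm that leaves the set `I` can be cut at its first exit from `I` after its last visit to
the block `[-m, m]²`. -/
theorem exists_exit_of_arm {ω : PercConfig} {m n : ℤ} (hm : 0 ≤ m)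
    (hopen : ∀ e ∈ edgesWithin (square (-m) m), ω e = true) {I B : Set (ℤ × ℤ)}
    (hI : ∀ u ∈ square (-m) m, u ∈ I) (hIB : I ⊆ B)
    (hB : ∀ u v, IsLatticeEdge s(u, v) → u ∈ I → v ∈ B) {a : ℤ × ℤ} (ha : a ∉ I)
    (h : ReflTransGen (OpenStepIn ω (square (-n) n)) (0, 0) a) :
    ∃ a', a' ∈ B ∧ a' ∉ I ∧ ReflTransGen (fun u v => OpenStep ω u v ∧ u ∈ B ∧ v ∈ B) a' (0, 0) ∧
      ReflTransGen (OpenStepOff ω m n) a' a := by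
  set T := square (-m) m with hT
  have h0 : (0, 0) ∈ T := by simp [hT, mem_square, hm]
  have hsymm : ∀ u v, OpenStepIn ω (square (-n) n) u v → OpenStepIn ω (square (-n) n) v u :=
    fun u v h => ⟨h.1.symm, h.2.2, h.2.1⟩
  obtain ⟨u, t, h1, h2, h3, h4, -⟩ := exists_first_exit (p := fun x => x ∉ T)
    (reflTransGen_symm hsymm h) (fun h => ha (hI a h)) (not_not.2 h0)
  have h4 := not_not.1 h4
  set r := fun x y => OpenStepIn ω (square (-n) n) x y ∧ y ∉ T with hr
  have hta : ReflTransGen r t a := by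
    refine ReflTransGen.head ⟨hsymm _ _ h3, h2⟩ (ReflTransGen.mono (fun x y h => ⟨h.1, h.2.2⟩) _ _
      (reflTransGen_symm (fun x y h => ⟨hsymm _ _ h.1, h.2.2, h.2.1⟩) h1))
  obtain ⟨x, y, h5, h6, h7, h8, h9⟩ := exists_first_exit (p := fun x => x ∈ I) hta (hI t h4) ha
  have hyB : y ∈ B := hB x y h7.1.1.1 h6
  refine ⟨y, hyB, h8, ?_, ?_⟩
  · refine reflTransGen_symm (fun u v h => ⟨h.1.symm, h.2.2, h.2.1⟩) ?_
    refine ReflTransGen.tail (b := x) (ReflTransGen.trans (b := t) ?_ ?_) ⟨h7.1.1, hIB h6, hyB⟩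
    · exact reflTransGen_of_mem_square (a := -m) (b := m) (fun u v h hu hv =>
        ⟨⟨h, hopen _ ((mem_edgesWithin h).2 ⟨hu, hv⟩)⟩, hIB (hI u hu), hIB (hI v hv)⟩) h0 h4
    · exact ReflTransGen.mono (fun u v h => ⟨h.1.1.1, hIB h.2.1, hIB h.2.2⟩) _ _ h5
  · have hoff : ∀ z, ReflTransGen r y z → z ∉ T := by
      intro z hz
      rcases ReflTransGen.cases_tail hz with h | ⟨w, -, h⟩
      · exact h ▸ h7.2
      · exact h.2
    exact ReflTransGen.mono (fun u v h => ⟨h.1.1, h.2⟩) _ _ (reflTransGen_and_of_forall h9 hoff)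

/-- The configuration seen from `x`. -/
def shift (x : ℤ × ℤ) : PercConfig → PercConfig :=
  twist (mapEdge (fun u => u + x) fun u v h => by
    rw [isLatticeEdge_iff] at h ⊢
    simpa using h) fun _ => false

theorem openStep_shift {x : ℤ × ℤ} {ω : PercConfig} {u v : ℤ × ℤ} :
    OpenStep (shift x ω) u v ↔ OpenStep ω (u + x) (v + x) := by
  refine openStep_twist_mapEdge _ |>.trans ⟨fun h => h.2, fun h => ⟨?_, h⟩⟩
  have := h.1
  rw [isLatticeEdge_iff] at this ⊢
  simpa using this

open Relation in
/-- The number of trifurcations in the square `[-L, L]²` with disjoint blocks is at most the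
size of the boundary of the square. -/
theorem card_trifurcation_le {m n L : ℤ} (hm : 0 ≤ m) (hn : 2 * L < n) (ω : PercConfig)
    (J : Finset (ℤ × ℤ))
    (hdisj : ∀ x ∈ J, ∀ y ∈ J, x ≠ y → 2 * m < |x.1 - y.1| ∨ 2 * m < |x.2 - y.2|)
    (hJ : ∀ x ∈ J, x ∈ square (-(L - 1 - m)) (L - 1 - m))
    (hω : ∀ x ∈ J, shift x ω ∈ trifurcation m n) :
    J.card ≤ (square (-L) L \ square (-(L - 1)) (L - 1)).card := by
  rw [← Fintype.card_coe]
  have hblocks : DisjointBlocks (OpenStepIn ω (square (-L) L))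
      (fun x : J => {v | v - x.1 ∈ square (-m) m}) fun x => x.1 := by
    refine ⟨fun u v h => ⟨h.1.symm, h.2.2, h.2.1⟩, fun x => ?_, fun x y hxy v hv hv' => ?_,
      fun x v hv => ?_⟩
    · simp [mem_square, hm]
    · have := hdisj x.1 x.2 y.1 y.2 fun h => hxy (Subtype.ext h)
      simp only [Set.mem_ofPred_eq, mem_square, Prod.fst_sub, Prod.snd_sub, lt_abs] at this hv hv'
      omega
    · have h0 : ((0, 0) : ℤ × ℤ) ∈ square (-m) m := by simp [mem_square, hm]
      have hx := hJ x.1 x.2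
      rw [mem_square] at hx
      have h1 := reflTransGen_of_mem_square (r := fun u v => OpenStep (shift x.1 ω) u v ∧
        u ∈ square (-m) m ∧ v ∈ square (-m) m) (fun u v h hu hv =>
          ⟨⟨h, (hω x.1 x.2).1 _ ((mem_edgesWithin h).2 ⟨hu, hv⟩)⟩, hu, hv⟩) hv h0
      have h2 := h1.lift (p := fun u v => OpenStepIn ω (square (-L) L) u v ∧
        u ∈ {v | v - x.1 ∈ square (-m) m} ∧ v ∈ {v | v - x.1 ∈ square (-m) m})
        (fun v => v + x.1) fun u v h => by
          obtain ⟨h1, hu, hv⟩ := h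
          refine ⟨⟨openStep_shift.1 h1, ?_, ?_⟩, by simpa using hu, by simpa using hv⟩
          · simp only [mem_square, Prod.fst_add, Prod.snd_add] at hu ⊢; omega
          · simp only [mem_square, Prod.fst_add, Prod.snd_add] at hv ⊢; omega
      have e : ((0, 0) : ℤ × ℤ) + x.1 = x.1 := zero_add _
      simpa only [Function.onFun, e, sub_add_cancel] using h2
  refine hblocks.card_le _ fun x => ?_
  have hx := hJ x.1 x.2
  obtain ⟨hopen, a, b, c, ⟨ha, hb, hc⟩, ⟨ha', hb', hc'⟩, hab, hac, hbc⟩ := hω x.1 x.2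
  obtain ⟨⟨x1, x2⟩, hxJ⟩ := x
  simp only at hx hopen ha' hb' hc' hab hac hbc ⊢
  set x : ℤ × ℤ := (x1, x2) with hxdef
  have hexit : ∀ {a}, a ∉ square (-(n - 1)) (n - 1) →
      ReflTransGen (OpenStepIn (shift x ω) (square (-n) n)) (0, 0) a →
      ∃ a', a' ∈ square (-L) L \ square (-(L - 1)) (L - 1) ∧ a' - x ∉ square (-m) m ∧
        ReflTransGen (OpenStepIn ω (square (-L) L)) a' x ∧
        ReflTransGen (OpenStepOff (shift x ω) m n) (a' - x) a := by
    intro a ha h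
    obtain ⟨a', h1, h2, h3, h4⟩ := exists_exit_of_arm hm hopen
      (I := {u | u + x ∈ square (-(L - 1)) (L - 1)}) (B := {u | u + x ∈ square (-L) L})
      (fun u hu => by
        simp only [Set.mem_ofPred_eq, mem_square, Prod.fst_add, Prod.snd_add] at hu hx ⊢; omega)
      (fun u hu => square_subset (by omega) (by omega) hu)
      (fun u v h hu => by
        have := isLatticeEdge_cases h
        simp only [Set.mem_ofPred_eq, mem_square, Prod.fst_add, Prod.snd_add] at hu ⊢; omega)
      (a := a) (fun h => ha (by
        simp only [Set.mem_ofPred_eq, mem_square, Prod.fst_add, Prod.snd_add] at h hx ⊢; omega)) h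
    refine ⟨a' + x, Finset.mem_sdiff.2 ⟨h1, h2⟩, fun h => h2 ?_, ?_, ?_⟩
    · simp only [add_sub_cancel_right, Set.mem_ofPred_eq, mem_square, Prod.fst_add, Prod.snd_add]
        at h hx ⊢
      omega
    · have := h3.lift (p := OpenStepIn ω (square (-L) L)) (fun v => v + x)
        fun u v h => ⟨openStep_shift.1 h.1, h.2⟩
      have e : ((0, 0) : ℤ × ℤ) + x = x := zero_add _
      simpa only [Function.onFun, e] using this
    · simpa using h4
  have hsymm : ∀ u v, OpenStepOff (shift x ω) m n u v → OpenStepOff (shift x ω) m n v u :=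
    fun u v h => ⟨⟨h.1.1.symm, h.1.2.2, h.1.2.1⟩, h.2.2, h.2.1⟩
  have hback : ∀ {a b a' b'}, ¬ ReflTransGen (OpenStepOff (shift x ω) m n) a b →
      ReflTransGen (OpenStepOff (shift x ω) m n) (a' - x) a →
      ReflTransGen (OpenStepOff (shift x ω) m n) (b' - x) b →
      ¬ ReflTransGen (StepOff (OpenStepIn ω (square (-L) L)) {v | v - x ∈ square (-m) m})
        a' b' := by
    intro a b a' b' hab ha hb h
    refine hab ((reflTransGen_symm hsymm ha).trans (ReflTransGen.trans ?_ hb))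
    refine h.lift (fun v => v - x) fun u v h => ?_
    obtain ⟨⟨h1, h2, h3⟩, h4⟩ := h
    refine ⟨⟨openStep_shift.2 (by simpa using h1), ?_, ?_⟩, h4⟩
    · simp only [mem_square, Prod.fst_sub, Prod.snd_sub] at h2 hx ⊢; omega
    · simp only [mem_square, Prod.fst_sub, Prod.snd_sub] at h3 hx ⊢; omega
  obtain ⟨a', ka1, ka2, ka3, ka4⟩ := hexit ha ha'
  obtain ⟨b', kb1, kb2, kb3, kb4⟩ := hexit hb hb'
  obtain ⟨c', kc1, kc2, kc3, kc4⟩ := hexit hc hc'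
  exact ⟨a', ka1, b', kb1, c', kc1, ⟨ka2, kb2, kc2⟩, ⟨ka3, kb3, kc3⟩, hback hab ka4 kb4,
    hback hac ka4 kc4, hback hbc kb4 kc4⟩

theorem sum_measure_le_of_card_le {Ω ι : Type*} [MeasurableSpace Ω] {μ : Measure Ω}
    [IsProbabilityMeasure μ] (J : Finset ι) (A : ι → Set Ω) (hA : ∀ i, MeasurableSet (A i)) (N : ℕ)
    (h : ∀ ω, ∀ J' ⊆ J, (∀ i ∈ J', ω ∈ A i) → J'.card ≤ N) : ∑ i ∈ J, μ (A i) ≤ N := by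
  classical
  calc ∑ i ∈ J, μ (A i) = ∑ i ∈ J, ∫⁻ ω, (A i).indicator 1 ω ∂μ := by
        simp only [lintegral_indicator_one (hA _)]
    _ = ∫⁻ ω, ∑ i ∈ J, (A i).indicator 1 ω ∂μ :=
        (lintegral_finsetSum _ fun i _ => measurable_one.indicator (hA i)).symm
    _ ≤ ∫⁻ _, N ∂μ := by
        refine lintegral_mono fun ω => ?_
        have h1 := h ω (J.filter fun i => ω ∈ A i) (Finset.filter_subset _ _)
          fun i hi => (Finset.mem_filter.1 hi).2
        have h2 : ∑ i ∈ J, (A i).indicator (1 : Ω → ENNReal) ω =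
            (J.filter fun i => ω ∈ A i).card := by
          simp [Set.indicator_apply]
        rw [h2]
        exact Nat.cast_le.2 h1
    _ = N := by simp

theorem card_boundary {L : ℕ} (hL : 0 < L) :
    (square (-L) L \ square (-(L - 1)) (L - 1)).card ≤ 8 * L := by
  rw [Finset.card_sdiff_of_subset (square_subset (by omega) (by omega))]
  simp only [square, Finset.card_product, Int.card_Icc]
  obtain ⟨k, rfl⟩ : ∃ k, L = k + 1 := ⟨L - 1, by omega⟩
  have h1 : ((k + 1 : ℕ) + 1 - -((k + 1 : ℕ) : ℤ)).toNat = 2 * k + 3 := by omega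
  have h2 : (((k + 1 : ℕ) : ℤ) - 1 + 1 - -(((k + 1 : ℕ) : ℤ) - 1)).toNat = 2 * k + 1 := by omega
  rw [h1, h2]
  have : (2 * k + 3) * (2 * k + 3) = (2 * k + 1) * (2 * k + 1) + 8 * (k + 1) := by ring
  omega

theorem IsFair.measure_clusterInfinite {μ : Measure PercConfig} (hμ : IsFair μ) :
    μ {ω | ClusterInfinite ω} = 0 := by
  by_contra hcon
  have := hμ.isProbabilityMeasure
  obtain ⟨m, k, hk⟩ := hμ.exists_measure_trifurcation hcon
  have hbound : ∀ K : ℕ, K * K ≤ 2 ^ k * (8 * ((2 * m + 2) * K)) := by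
    intro K
    rcases Nat.eq_zero_or_pos K with rfl | hK
    · simp
    set L : ℕ := (2 * m + 2) * K with hL
    set n : ℤ := 2 * L + m + 1 with hn
    set centre : ℕ × ℕ → ℤ × ℤ := fun i => (((2 * m + 2) * i.1 : ℕ), ((2 * m + 2) * i.2 : ℕ))
    set J := (Finset.range K ×ˢ Finset.range K).image centre with hJ
    have hcentre : centre.Injective := by
      intro i j hij
      simp only [centre, Prod.mk.injEq, Nat.cast_inj] at hij
      exact Prod.ext (Nat.eq_of_mul_eq_mul_left (by omega) hij.1)
        (Nat.eq_of_mul_eq_mul_left (by omega) hij.2)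
    have hcard : J.card = K * K := by
      rw [hJ, Finset.card_image_of_injective _ hcentre]
      simp
    have hgap : ∀ i j : ℕ, i < j → (2 * m + 2) * i + (2 * m + 2) ≤ (2 * m + 2) * j := fun i j h =>
      (Nat.mul_le_mul_left (2 * m + 2) h : (2 * m + 2) * (i + 1) ≤ _)
    have hdet := determinedBy_trifurcation (m := m) (n := n) (by omega)
    have hpres : ∀ x, MeasurePreserving (shift x) μ μ := fun x =>
      hμ.measurePreserving_twist (mapEdge_injective (add_left_injective x)) _
    have hsum := sum_measure_le_of_card_le (μ := μ) J (fun x => shift x ⁻¹' trifurcation m n)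
      (fun x => (hpres x).measurable hdet.measurableSet) (8 * L) fun ω J' hJ' h => by
        refine (card_trifurcation_le (m := m) (n := n) (L := L) (by omega) (by omega) ω J'
          (fun x hx y hy hxy => ?_) (fun x hx => ?_) h).trans
            (card_boundary (Nat.mul_pos (by omega) hK))
        · obtain ⟨i, -, rfl⟩ := Finset.mem_image.1 (hJ' hx)
          obtain ⟨j, -, rfl⟩ := Finset.mem_image.1 (hJ' hy)
          have hij : i.1 ≠ j.1 ∨ i.2 ≠ j.2 := by
            by_contra! h
            exact hxy (congrArg centre (Prod.ext h.1 h.2))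
          simp only [centre, lt_abs]
          have g1 := hgap i.1 j.1
          have g2 := hgap j.1 i.1
          have g3 := hgap i.2 j.2
          have g4 := hgap j.2 i.2
          generalize (2 * m + 2) * i.1 = p1 at *
          generalize (2 * m + 2) * i.2 = p2 at *
          generalize (2 * m + 2) * j.1 = q1 at *
          generalize (2 * m + 2) * j.2 = q2 at *
          omega
        · obtain ⟨i, hi, rfl⟩ := Finset.mem_image.1 (hJ' hx)
          simp only [Finset.mem_product, Finset.mem_range] at hi
          have g1 := hgap i.1 K hi.1
          have g2 := hgap i.2 K hi.2
          rw [mem_square]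
          simp only [centre]
          rw [← hL] at g1 g2
          generalize (2 * m + 2) * i.1 = p1 at *
          generalize (2 * m + 2) * i.2 = p2 at *
          omega
    simp only [fun x => (hpres x).measure_preimage hdet.measurableSet.nullMeasurableSet,
      Finset.sum_const, nsmul_eq_mul, hcard] at hsum
    have h1 : ((K * K : ℕ) : ENNReal) ≤ ((2 ^ k * (8 * L) : ℕ) : ENNReal) :=
      calc ((K * K : ℕ) : ENNReal) = (K * K : ℕ) * 1 := (mul_one _).symm
        _ ≤ (K * K : ℕ) * (2 ^ k * μ (trifurcation m n)) :=
          mul_le_mul' le_rfl (hk n (by omega))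
        _ = 2 ^ k * ((K * K : ℕ) * μ (trifurcation m n)) := by ring
        _ ≤ 2 ^ k * (8 * L : ℕ) := mul_le_mul' le_rfl hsum
        _ = _ := by push_cast; ring
    exact_mod_cast h1
  have h1 := hbound (2 ^ k * (8 * (2 * m + 2)) + 1)
  have h2 : 2 ^ k * (8 * ((2 * m + 2) * (2 ^ k * (8 * (2 * m + 2)) + 1))) =
      (2 ^ k * (8 * (2 * m + 2))) * (2 ^ k * (8 * (2 * m + 2)) + 1) := by ring
  rw [h2] at h1
  have := Nat.le_of_mul_le_mul_right h1 (by omega)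
  omega

theorem IsBernoulliProduct.isFair {μ : Measure PercConfig} (h : IsBernoulliProduct (1 / 2) μ) :
    IsFair μ := by
  have h1 : ENNReal.ofReal (1 / 2) = 2⁻¹ := by
    rw [one_div, ENNReal.ofReal_inv_of_pos (by norm_num), ENNReal.ofReal_ofNat]
  have h2 : (1 : ℝ) - 1 / 2 = 1 / 2 := by norm_num
  intro S b
  rw [cyl, h S b]
  simp only [h2, ite_self, h1, Finset.prod_const]

/-- **Harris.** For bond percolation on `ℤ²` at `p = 1/2` the probability that the origin
lies in an infinite open cluster is zero: `θ(1/2) = 0`.  Consequently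
`p_c(ℤ²) = sup {p : θ(p) = 0} ≥ 1/2`. -/
theorem harris_theorem
    (P : ℝ → Measure PercConfig)
    (hP : ∀ p ∈ Set.Ioo (0 : ℝ) 1,
      IsProbabilityMeasure (P p) ∧ IsBernoulliProduct p (P p)) :
    P (1 / 2) {ω : PercConfig | ClusterInfinite ω} = 0 ∧
      1 / 2 ≤ sSup {p ∈ Set.Ioo (0 : ℝ) 1 |
        P p {ω : PercConfig | ClusterInfinite ω} = 0} := by
  have h0 : P (1 / 2) {ω : PercConfig | ClusterInfinite ω} = 0 :=
    (hP (1 / 2) (by norm_num)).2.isFair.measure_clusterInfinite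
  exact ⟨h0, le_csSup ⟨1, fun p hp => hp.1.2.le⟩ ⟨by norm_num, h0⟩⟩
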